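/- arXiv:2001.07981 — 2 statements merged into one kernel-verified Lean document; each statement's English description precedes it below -/
import Mathlib

section
/- Let M ⊆ N₁, N₂ ⊆ N be finite-dimensional von Neumann algebras with conditional expectations E^M, E₁, E₂ (onto M, N₁, N₂ respectively) forming a commuting square, i.e. E₁ ∘ E₂ = E₂ ∘ E₁ = E^M. Then for any density matrix ρ on N one has the strong subadditivity-type inequality D(ρ‖E^M_*(ρ)) ≤ D(ρ‖E₁_*(ρ)) + D(ρ‖E₂_*(ρ)), where D is the quantum relative entropy and E_* denotes the Hilbert–Schmidt adjoint of E. -/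
open Matrix ComplexOrder

noncomputable section

/-- Matrix logarithm via the functional calculus. -/
def matLog {d : ℕ} (A : Matrix (Fin d) (Fin d) ℂ) : Matrix (Fin d) (Fin d) ℂ :=
  cfc Real.log A

/-- Quantum relative entropy `D(ρ‖σ) = Tr[ρ(log ρ − log σ)]`. -/
def relEnt {d : ℕ} (ρ σ : Matrix (Fin d) (Fin d) ℂ) : ℝ :=
  ((ρ * (matLog ρ - matLog σ)).trace).re

section Helpers

/-- Square complex matrices. -/
abbrev Mt (d : ℕ) := Matrix (Fin d) (Fin d) ℂ

lemma eig {d : ℕ} {A : Mt d} (hA : A.IsHermitian) :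
    ∃ (U : Mt d) (l : Fin d → ℝ), Uᴴ * U = 1 ∧ U * Uᴴ = 1 ∧
      (∀ f : ℝ → ℝ, cfc f A = U * diagonal (fun i => ((f (l i) : ℝ) : ℂ)) * Uᴴ) ∧
      A = U * diagonal (fun i => ((l i : ℝ) : ℂ)) * Uᴴ ∧
      (A.PosSemidef → ∀ i, 0 ≤ l i) ∧ (A.PosDef → ∀ i, 0 < l i) := by
  refine ⟨hA.eigenvectorUnitary, hA.eigenvalues, ?_, ?_, ?_, ?_, ?_, ?_⟩
  · exact Unitary.coe_star_mul_self hA.eigenvectorUnitary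
  · exact Unitary.coe_mul_star_self hA.eigenvectorUnitary
  · intro f
    rw [hA.cfc_eq, IsHermitian.cfc, Unitary.conjStarAlgAut_apply]
    rfl
  · conv_lhs => rw [hA.spectral_theorem, Unitary.conjStarAlgAut_apply]
    rfl
  · intro h i; exact h.eigenvalues_nonneg i
  · intro h i; exact h.eigenvalues_pos i

lemma spec_dec {d : ℕ} {A : Mt d} (hA : A.IsHermitian) :
    ∃ (l : Fin d → ℝ) (P : Fin d → Mt d), (∀ i, (P i).PosSemidef) ∧ ∑ i, P i = 1 ∧
      A = ∑ i, (l i : ℂ) • P i ∧ A * A = ∑ i, ((l i : ℂ) * (l i : ℂ)) • P i := by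
  obtain ⟨U, l, h1, h2, -, h4, -, -⟩ := eig hA
  have key : ∀ c : Fin d → ℂ, ∑ i, c i • (U * diagonal (Pi.single i (1 : ℂ)) * Uᴴ)
      = U * diagonal c * Uᴴ := by
    intro c
    have : diagonal c = ∑ i, c i • diagonal (Pi.single i (1 : ℂ)) := by
      ext a b
      rw [Matrix.sum_apply]
      by_cases hab : a = b
      · subst hab
        simp [Pi.single_apply]
      · simp [hab]
    rw [this, Finset.mul_sum, Finset.sum_mul]
    simp
  refine ⟨l, fun i => U * diagonal (Pi.single i (1 : ℂ)) * Uᴴ, ?_, ?_, ?_, ?_⟩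
  · intro i
    apply PosSemidef.mul_mul_conjTranspose_same
    apply PosSemidef.diagonal
    intro j
    by_cases h : i = j
    · subst h; simp
    · simp [Ne.symm h]
  · have := key 1
    simpa [h2] using this
  · rw [key]; exact h4
  · rw [key]
    have : A * A = U * diagonal (fun i => (l i : ℂ)) * (Uᴴ * U) * diagonal (fun i => (l i : ℂ)) * Uᴴ := by
      conv_lhs => rw [h4]
      simp only [Matrix.mul_assoc]
    rw [this, h1, Matrix.mul_one, Matrix.mul_assoc U, diagonal_mul_diagonal]

/-- `E` is a (positive, unital) conditional expectation onto `N`. -/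
structure IsCE {d : ℕ} (N : StarSubalgebra ℂ (Mt d)) (E : Mt d →ₗ[ℂ] Mt d) : Prop where
  range : ∀ X, E X ∈ N
  id : ∀ X ∈ N, E X = X
  unital : E 1 = 1
  pos : ∀ X : Mt d, X.PosSemidef → (E X).PosSemidef

namespace IsCE
variable {d : ℕ} {N : StarSubalgebra ℂ (Mt d)} {E : Mt d →ₗ[ℂ] Mt d}

lemma herm (h : IsCE N E) {A : Mt d} (hA : A.IsHermitian) : (E A).IsHermitian := by
  obtain ⟨l, P, h1, h2, h3, -⟩ := spec_dec hA
  rw [h3, map_sum]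
  simp only [map_smul, IsHermitian, conjTranspose_sum, conjTranspose_smul]
  refine Finset.sum_congr rfl fun i _ => ?_
  rw [(h.pos _ (h1 i)).1]
  simp

lemma kadison (h : IsCE N E) {A : Mt d} (hA : A.IsHermitian) :
    (E (A * A) - E A * E A).PosSemidef := by
  have hS := h.herm hA
  obtain ⟨l, P, h1, h2, h3, h4⟩ := spec_dec hA
  have e1 : ∑ i, E (P i) = 1 := by rw [← map_sum, h2, h.unital]
  have e2 : E A = ∑ i, (l i : ℂ) • E (P i) := by
    conv_lhs => rw [h3]
    simp
  have e3 : E (A * A) = ∑ i, ((l i : ℂ) * (l i : ℂ)) • E (P i) := by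
    rw [h4]
    simp
  set S := E A with hSdef
  have : E (A * A) - S * S = ∑ i, ((l i : ℂ) • 1 - S) * E (P i) * ((l i : ℂ) • 1 - S)ᴴ := by
    have t : ∀ i, ((l i : ℂ) • 1 - S) * E (P i) * ((l i : ℂ) • 1 - S)ᴴ =
        ((l i : ℂ) * (l i : ℂ)) • E (P i) - S * ((l i : ℂ) • E (P i)) - ((l i : ℂ) • E (P i)) * S
          + S * E (P i) * S := by
      intro i
      rw [conjTranspose_sub, hS.eq]
      simp only [conjTranspose_smul, conjTranspose_one, sub_mul, mul_sub, smul_mul_assoc,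
        mul_smul_comm, one_mul, mul_one, Complex.star_def, Complex.conj_ofReal]
      module
    simp only [t, Finset.sum_add_distrib, Finset.sum_sub_distrib, ← Finset.mul_sum,
      ← Finset.sum_mul, ← e2, ← e3, e1]
    simp
  rw [this]
  exact posSemidef_sum _ fun i _ => (h.pos _ (h1 i)).mul_mul_conjTranspose_same _

lemma star_map (h : IsCE N E) (X : Mt d) : E Xᴴ = (E X)ᴴ := by
  have h1 : (X + Xᴴ).IsHermitian := by simp [IsHermitian, add_comm]
  have h2 : (Complex.I • (X - Xᴴ)).IsHermitian := by
    simp only [IsHermitian, conjTranspose_smul, conjTranspose_sub, conjTranspose_conjTranspose]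
    simp only [Complex.star_def, Complex.conj_I]
    module
  have k1 := (h.herm h1).eq
  have k2 := (h.herm h2).eq
  simp only [map_add, conjTranspose_add, map_smul, map_sub, conjTranspose_smul,
    conjTranspose_sub] at k1 k2
  have k3 : Complex.I • ((E X)ᴴ - (E Xᴴ)ᴴ + (E X - E Xᴴ)) = 0 := by
    rw [smul_add, ← k2]; simp
  have k4 := (smul_eq_zero.mp k3).resolve_left Complex.I_ne_zero
  have k5 : (2 : ℂ) • (E Xᴴ - (E X)ᴴ) = 0 := by
    rw [two_smul]
    calc E Xᴴ - (E X)ᴴ + (E Xᴴ - (E X)ᴴ) = ((E X + E Xᴴ) - ((E X)ᴴ + (E Xᴴ)ᴴ))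
          - ((E X)ᴴ - (E Xᴴ)ᴴ + (E X - E Xᴴ)) := by abel
      _ = 0 := by rw [k1, k4]; simp
  have := (smul_eq_zero.mp k5).resolve_left two_ne_zero
  exact sub_eq_zero.mp this

/-- the symmetrized Schwarz defect -/
lemma jschwarz (h : IsCE N E) (X : Mt d) :
    (E (Xᴴ * X + X * Xᴴ) - ((E X)ᴴ * E X + E X * (E X)ᴴ)).PosSemidef := by
  have h1 : (X + Xᴴ).IsHermitian := by simp [IsHermitian, add_comm]
  have h2 : (Complex.I • (X - Xᴴ)).IsHermitian := by
    simp only [IsHermitian, conjTranspose_smul, conjTranspose_sub, conjTranspose_conjTranspose]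
    simp only [Complex.star_def, Complex.conj_I]
    module
  have k := (h.kadison h1).add (h.kadison h2)
  have k2 := k.smul (a := (1 / 2 : ℝ)) (by norm_num)
  convert k2 using 1
  simp only [map_add, map_smul, map_sub, h.star_map, add_mul, mul_add, sub_mul, mul_sub,
    smul_mul_assoc, mul_smul_comm]
  simp only [smul_sub, smul_smul, Complex.I_mul_I]
  module

end IsCE

lemma cfc_poly {d : ℕ} (f : ℝ → ℝ) (s : Finset ℝ) : ∃ p : Polynomial ℝ, ∀ A : Mt d,
    A.IsHermitian → spectrum ℝ A ⊆ s → cfc f A = Polynomial.aeval A p := by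
  refine ⟨Lagrange.interpolate s _root_.id f, fun A hA hs => ?_⟩
  have hsa : IsSelfAdjoint A := hA
  rw [← cfc_polynomial _ A hsa]
  apply cfc_congr
  intro x hx
  exact (Lagrange.eval_interpolate_at_node (v := _root_.id) f (Function.injective_id.injOn)
    (hs hx)).symm

lemma psd_lin {d : ℕ} {H0 H : Mt d} (hH : H.IsHermitian)
    (h : ∀ r : ℝ, (H0 + (r : ℂ) • H).PosSemidef) : H = 0 := by
  have key : ∀ x : Fin d → ℂ, (star x ⬝ᵥ (H *ᵥ x)).re = 0 := by
    intro x
    have h2 : ∀ r : ℝ, 0 ≤ (star x ⬝ᵥ (H0 *ᵥ x)).re + r * (star x ⬝ᵥ (H *ᵥ x)).re := by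
      intro r
      have := (h r).re_dotProduct_nonneg x
      rw [add_mulVec, smul_mulVec, dotProduct_add, dotProduct_smul] at this
      simpa using this
    set c := (star x ⬝ᵥ (H0 *ᵥ x)).re
    set k := (star x ⬝ᵥ (H *ᵥ x)).re
    by_contra hk
    have := h2 (-(c + 1) / k)
    rw [div_mul_cancel₀ _ hk] at this
    linarith
  have hp : H.PosSemidef := by
    apply PosSemidef.of_dotProduct_mulVec_nonneg hH
    intro x
    rw [Complex.nonneg_iff]
    refine ⟨(key x).ge, ?_⟩
    exact (hH.im_star_dotProduct_mulVec_self x).symm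
  have hz : ∀ x, H *ᵥ x = 0 := by
    intro x
    rw [← hp.dotProduct_mulVec_zero_iff]
    apply Complex.ext
    · exact key x
    · exact hH.im_star_dotProduct_mulVec_self x
  exact Matrix.ext_of_mulVec_single fun i => by rw [hz, zero_mulVec]

namespace IsCE
variable {d : ℕ} {N : StarSubalgebra ℂ (Mt d)} {E : Mt d →ₗ[ℂ] Mt d}

lemma jordan (h : IsCE N E) {a : Mt d} (ha : a ∈ N) (Y : Mt d) :
    E (a * Y + Y * a) = a * E Y + E Y * a := by
  have main : ∀ b ∈ N, ∀ Y : Mt d, (E (bᴴ * Y + Y * bᴴ) - (bᴴ * E Y + E Y * bᴴ)) +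
      (E (bᴴ * Y + Y * bᴴ) - (bᴴ * E Y + E Y * bᴴ))ᴴ = 0 := by
    intro b hb Y
    apply psd_lin (H0 := E (Yᴴ * Y + Y * Yᴴ) - ((E Y)ᴴ * E Y + E Y * (E Y)ᴴ))
    · simp [IsHermitian, add_comm]
    · intro r
      have hs : bᴴ ∈ N := star_mem hb
      have k := h.jschwarz (Y + (r : ℂ) • b)
      convert k using 1
      have e1 := h.id _ (mul_mem hs hb)
      have e2 := h.id _ (mul_mem hb hs)
      have e3 := h.id _ hb
      simp only [conjTranspose_add, conjTranspose_smul, Complex.star_def, Complex.conj_ofReal,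
        map_add, map_smul, add_mul, mul_add, smul_mul_assoc, mul_smul_comm, conjTranspose_sub,
        ← h.star_map, conjTranspose_mul, conjTranspose_conjTranspose, e1, e2, e3]
      module
  have hs : aᴴ ∈ N := star_mem ha
  have m1 := main _ hs Y
  have m2 := main _ hs (Complex.I • Y)
  simp only [conjTranspose_conjTranspose] at m1 m2
  have e : E (a * (Complex.I • Y) + (Complex.I • Y) * a) -
      (a * E (Complex.I • Y) + E (Complex.I • Y) * a) =
      Complex.I • (E (a * Y + Y * a) - (a * E Y + E Y * a)) := by
    simp only [map_add, map_smul, smul_mul_assoc, mul_smul_comm]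
    module
  rw [e, conjTranspose_smul] at m2
  set B := E (a * Y + Y * a) - (a * E Y + E Y * a)
  have m3 : Bᴴ = -B := by rw [eq_neg_iff_add_eq_zero, add_comm]; exact m1
  rw [m3] at m2
  have m4 : (2 * Complex.I) • B = 0 := by
    rw [← m2]
    simp only [Complex.star_def, Complex.conj_I]
    module
  have := (smul_eq_zero.mp m4).resolve_left (by simp)
  exact sub_eq_zero.mp this

section proj

lemma off
    (h : IsCE N E) {p q : Mt d} (hp : p ∈ N) (hq : q ∈ N)
    (pp : p * p = p) (qq : q * q = q) (pq : p * q = 0) (qp : q * p = 0)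
    (ps : pᴴ = p) (qs : qᴴ = q)
    (x : Mt d) : q * E (p * x * q) * p = 0 := by
  have pp' : ∀ z, p * (p * z) = p * z := fun z => by rw [← mul_assoc, pp]
  have qq' : ∀ z, q * (q * z) = q * z := fun z => by rw [← mul_assoc, qq]
  have pq' : ∀ z, p * (q * z) = 0 := fun z => by rw [← mul_assoc, pq, zero_mul]
  have qp' : ∀ z, q * (p * z) = 0 := fun z => by rw [← mul_assoc, qp, zero_mul]
  set y := E (p * x * q) with hy
  set n := q * y * p with hn
  have hnN : n ∈ N := mul_mem (mul_mem hq (h.range _)) hp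
  have hnsN : nᴴ ∈ N := star_mem hnN
  have hns : nᴴ = p * yᴴ * q := by
    simp only [hn, conjTranspose_mul, ps, qs, mul_assoc]
  have c1 : (p * x * q)ᴴ * n = 0 := by
    simp only [hn, conjTranspose_mul, ps, qs, mul_assoc, pq', mul_zero]
  have c2 : nᴴ * (p * x * q) = 0 := by
    simp only [hns, mul_assoc, qp', mul_zero]
  have c3 : n * (p * x * q)ᴴ = 0 := by
    simp only [hn, conjTranspose_mul, ps, qs, mul_assoc, pq', mul_zero]
  have c4 : (p * x * q) * nᴴ = 0 := by
    simp only [hns, mul_assoc, qp', mul_zero]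
  have H0 : yᴴ * n + nᴴ * y + y * nᴴ + n * yᴴ = 0 := by
    apply psd_lin (H0 := E ((p * x * q)ᴴ * (p * x * q) + (p * x * q) * (p * x * q)ᴴ)
      - (yᴴ * y + y * yᴴ))
    · simp only [IsHermitian, conjTranspose_add, conjTranspose_mul, conjTranspose_conjTranspose]
      abel
    · intro r
      have k := h.jschwarz (p * x * q + ((-r : ℝ) : ℂ) • n)
      convert k using 1
      have e1 := h.id _ (mul_mem hnsN hnN)
      have e2 := h.id _ (mul_mem hnN hnsN)
      have e3 := h.id _ hnN
      rw [map_add E (p * x * q), ← hy, map_smul, e3]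
      generalize p * x * q = w at *
      simp only [conjTranspose_add, conjTranspose_smul, Complex.star_def, Complex.conj_ofReal,
        map_add, map_smul, add_mul, mul_add, smul_mul_assoc, mul_smul_comm, c1, c2, c3, c4,
        e1, e2, smul_zero, add_zero, zero_add]
      push_cast
      module
  have qn : q * n = n := by simp only [hn, mul_assoc, qq']
  have np : n * p = n := by simp only [hn, mul_assoc, pp]
  have nq : nᴴ * q = nᴴ := by rw [hns, mul_assoc, qq]
  have pn : p * nᴴ = nᴴ := by rw [hns, ← mul_assoc, ← mul_assoc, pp]
  have t1 : (yᴴ * n).trace = (nᴴ * n).trace := by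
    have : nᴴ * n = p * (yᴴ * n) := by rw [hns, mul_assoc, mul_assoc, qn]
    rw [this, Matrix.trace_mul_comm p, mul_assoc, np]
  have t2 : (nᴴ * y).trace = (nᴴ * n).trace := by
    have : nᴴ * n = (nᴴ * y) * p := by
      calc nᴴ * n = nᴴ * (q * y * p) := rfl
        _ = (nᴴ * q) * y * p := by simp only [mul_assoc]
        _ = _ := by rw [nq]
    rw [this, Matrix.trace_mul_comm _ p, ← mul_assoc, pn]
  have t := congrArg Matrix.trace H0
  rw [trace_add, trace_add, trace_add, Matrix.trace_mul_comm y, Matrix.trace_mul_comm n, t1, t2,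
    trace_zero] at t
  have t' : (nᴴ * n).trace = 0 := by linear_combination t / 4
  exact trace_conjTranspose_mul_self_eq_zero_iff.mp t'

lemma corner
    (h : IsCE N E) {p q : Mt d} (hp : p ∈ N) (hq : q ∈ N)
    (pp : p * p = p) (qq : q * q = q) (pq : p * q = 0) (qp : q * p = 0)
    (ps : pᴴ = p) (qs : qᴴ = q)
    (x : Mt d) : p * E (p * x * q) = E (p * x * q) ∧ E (p * x * q) * p = 0 := by
  have j := h.jordan hp (p * x * q)
  have o := off h hp hq pp qq pq qp ps qs x
  have j2 := h.jordan hq (p * x * q)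
  have e1 : p * (p * x * q) + p * x * q * p = p * x * q := by
    rw [mul_assoc _ q p, qp, mul_zero, add_zero, ← mul_assoc, ← mul_assoc, pp]
  have e2 : q * (p * x * q) + p * x * q * q = p * x * q := by
    rw [mul_assoc _ q q, qq, ← mul_assoc, ← mul_assoc, qp, zero_mul, zero_mul, zero_add]
  rw [e1] at j
  rw [e2] at j2
  set y := E (p * x * q)
  have k1 : p * y * p = 0 := by
    have := congrArg (fun z => p * z) j
    simp only [mul_add, ← mul_assoc, pp] at this
    exact left_eq_add.mp this
  have k2 : y * p = 0 := by
    have := congrArg (fun z => z * p) j2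
    simp only [add_mul, mul_assoc, qp, mul_zero, add_zero] at this
    rw [this, ← mul_assoc]; exact o
  refine ⟨?_, k2⟩
  rw [k2, add_zero] at j
  exact j.symm

lemma diagc
    (h : IsCE N E) {p q : Mt d} (hp : p ∈ N) (hq : q ∈ N)
    (pp : p * p = p) (qq : q * q = q) (pq : p * q = 0) (qp : q * p = 0)
    (ps : pᴴ = p) (qs : qᴴ = q)
    (x : Mt d) : p * E (p * x * p) = E (p * x * p) ∧ q * E (p * x * p) = 0 := by
  have j := h.jordan hp (p * x * p)
  have e1 : p * (p * x * p) + p * x * p * p = p * x * p + p * x * p := by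
    rw [mul_assoc _ p p, pp, ← mul_assoc, ← mul_assoc, pp]
  rw [e1, map_add] at j
  have j2 := h.jordan hq (p * x * p)
  have e2 : q * (p * x * p) + p * x * p * q = 0 := by
    rw [mul_assoc _ p q, pq, ← mul_assoc, ← mul_assoc, qp, zero_mul, zero_mul, mul_zero, zero_add]
  rw [e2, map_zero] at j2
  set y := E (p * x * p)
  have k1 : p * y = p * y * p := by
    have := congrArg (fun z => p * z) j
    simp only [mul_add, ← mul_assoc, pp] at this
    exact add_left_cancel this
  have k2 : y * p = p * y * p := by
    have := congrArg (fun z => z * p) j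
    simp only [add_mul, mul_assoc, pp] at this
    rw [mul_assoc]
    exact add_right_cancel this
  have k3 : y + y = p * y + p * y := by rw [j, k2, ← k1]
  have k4 : p * y = y := by
    rw [← two_smul ℂ, ← two_smul ℂ (p * y)] at k3
    exact (smul_right_injective _ (two_ne_zero' ℂ) k3).symm
  refine ⟨k4, ?_⟩
  rw [← k4, ← mul_assoc, qp, zero_mul]

lemma proj_mul
    (h : IsCE N E) {p q : Mt d} (hp : p ∈ N) (hq : q ∈ N)
    (pp : p * p = p) (qq : q * q = q) (pq : p * q = 0) (qp : q * p = 0)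
    (ps : pᴴ = p) (qs : qᴴ = q)
    (hpq : p + q = 1) (x : Mt d) : E (p * x) = p * E x := by
  have dx : x = p * x * p + q * x * q + p * x * q + q * x * p := by
    calc x = (p + q) * x * (p + q) := by rw [hpq, one_mul, mul_one]
      _ = _ := by simp only [add_mul, mul_add]; abel
  have dpx : p * x = p * x * p + p * x * q := by
    rw [← mul_add, hpq, mul_one]
  have a1 := diagc h hp hq pp qq pq qp ps qs x
  have a2 := diagc h hq hp qq pp qp pq qs ps x
  have a3 := corner h hp hq pp qq pq qp ps qs x
  have a4 := corner h hq hp qq pp qp pq qs ps x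
  have a5 : p * E (q * x * p) = 0 := by
    rw [← a4.1, ← mul_assoc, pq, zero_mul]
  rw [dpx, map_add]
  conv_rhs => rw [dx]
  simp only [map_add, mul_add, a1.1, a2.2, a3.1, a5, add_zero]
end proj

lemma cfc_mem {A : Mt d} (hA : A.IsHermitian) (hAN : A ∈ N) (f : ℝ → ℝ) : cfc f A ∈ N := by
  obtain ⟨p, hp⟩ := cfc_poly (d := d) f A.finite_real_spectrum.toFinset
  rw [hp A hA (by simp), Polynomial.aeval_eq_sum_range]
  refine sum_mem fun i _ => ?_
  rw [← Complex.coe_smul]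
  exact N.smul_mem (pow_mem hAN i) _

lemma left_mul (h : IsCE N E) {a : Mt d} (ha : a ∈ N) (x : Mt d) : E (a * x) = a * E x := by
  have hproj : ∀ p ∈ N, p * p = p → pᴴ = p → E (p * x) = p * E x := by
    intro p hp pp ps
    exact proj_mul h hp (q := 1 - p) (sub_mem (one_mem N) hp) pp
      (by simp [mul_sub, sub_mul, pp]) (by simp [mul_sub, pp])
      (by simp [sub_mul, pp]) ps (by simp [ps]) (by simp) x
  have hher : ∀ b ∈ N, b.IsHermitian → E (b * x) = b * E x := by
    intro b hb hbh
    have hsa : IsSelfAdjoint b := hbh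
    have hfin := b.finite_real_spectrum
    let P : ℝ → Mt d := fun c => cfc (fun t => if t = c then (1 : ℝ) else 0) b
    have cont : ∀ g : ℝ → ℝ, ContinuousOn g (spectrum ℝ b) := fun g => hfin.continuousOn g
    have hb2 : b = ∑ c ∈ hfin.toFinset, c • P c := by
      simp only [P]
      conv_lhs => rw [← cfc_id' ℝ b]
      have : ∀ c : ℝ, c • cfc (fun t => if t = c then (1 : ℝ) else 0) b =
          cfc (fun t => c • if t = c then (1 : ℝ) else 0) b := fun c => by
        rw [cfc_smul _ _ _ (cont _)]
      simp only [this]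
      rw [← cfc_sum _ _ _ (fun _ _ => cont _)]
      apply cfc_congr
      intro t ht
      simp [ht]
    have hP : ∀ c, E (P c * x) = P c * E x := by
      intro c
      apply hproj _ (cfc_mem hbh hb _)
      · refine (cfc_mul (fun t => if t = c then (1 : ℝ) else 0)
          (fun t => if t = c then (1 : ℝ) else 0) b (cont _) (cont _)).symm.trans (cfc_congr ?_)
        intro t _
        by_cases hc : t = c <;> simp [hc]
      · exact cfc_predicate (R := ℝ) (p := IsSelfAdjoint) _ b
    have sm : ∀ c : ℝ, ∀ X : Mt d, c • X = (c : ℂ) • X := fun c X => (Complex.coe_smul c X).symm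
    rw [hb2]
    simp only [Finset.sum_mul, map_sum, sm, smul_mul_assoc, map_smul, hP]
  have h1 : (a + aᴴ).IsHermitian := by simp [IsHermitian, add_comm]
  have h2 : (Complex.I • (a - aᴴ)).IsHermitian := by
    simp only [IsHermitian, conjTranspose_smul, conjTranspose_sub, conjTranspose_conjTranspose]
    simp only [Complex.star_def, Complex.conj_I]
    module
  have hs : aᴴ ∈ N := star_mem ha
  have k1 := hher _ (add_mem ha hs) h1
  have k2 := hher _ (N.smul_mem (sub_mem ha hs) Complex.I) h2
  have e : a = (1 / 2 : ℂ) • (a + aᴴ) + (-Complex.I / 2) • (Complex.I • (a - aᴴ)) := by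
    rw [smul_smul, show -Complex.I / 2 * Complex.I = 1 / 2 by
      rw [div_mul_eq_mul_div, neg_mul, Complex.I_mul_I]; norm_num]
    module
  rw [e]
  simp only [add_mul _ _ x, add_mul _ _ (E x), smul_mul_assoc (1 / 2 : ℂ),
    smul_mul_assoc (-Complex.I / 2), map_add, map_smul]
  rw [← map_add, ← add_mul, k1, k2, add_mul a]

lemma right_mul (h : IsCE N E) {a : Mt d} (ha : a ∈ N) (x : Mt d) : E (x * a) = E x * a := by
  have hs : aᴴ ∈ N := star_mem ha
  have := h.left_mul hs xᴴ
  rw [← conjTranspose_mul, h.star_map, h.star_map, ← conjTranspose_mul] at this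
  exact conjTranspose_injective this

lemma schwarz (h : IsCE N E) (X : Mt d) : (E (Xᴴ * X) - (E X)ᴴ * E X).PosSemidef := by
  have hE := h.range X
  have hEs : (E X)ᴴ ∈ N := star_mem hE
  have k := h.pos _ (posSemidef_conjTranspose_mul_self (X - E X))
  convert k using 1
  rw [conjTranspose_sub, sub_mul, mul_sub, mul_sub, map_sub, map_sub, map_sub, h.right_mul hE,
    h.left_mul hEs, h.left_mul hEs, h.star_map, h.id _ hE]
  abel

end IsCE

section Logs
open scoped MatrixOrder Matrix.Norms.L2Operator

lemma psd_fact {d : ℕ} {A : Mt d} (hA : A.PosSemidef) : ∃ B : Mt d, A = Bᴴ * B :=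
  CStarAlgebra.nonneg_iff_eq_star_mul_self.mp hA.nonneg

lemma psd_mul_comm {d : ℕ} {A B : Mt d} (hA : A.PosSemidef) (hB : B.PosSemidef)
    (h : Commute A B) : (A * B).PosSemidef := by
  rw [← nonneg_iff_posSemidef]
  exact Commute.mul_nonneg hA.nonneg hB.nonneg h

lemma pd_mul_comm {d : ℕ} {A B : Mt d} (hA : A.PosDef) (hB : B.PosDef)
    (h : Commute A B) : (A * B).PosDef := by
  rw [(psd_mul_comm hA.posSemidef hB.posSemidef h).posDef_iff_isUnit]
  exact hA.isUnit.mul hB.isUnit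

lemma cfc_comm {d : ℕ} {A T : Mt d} (hA : A.IsHermitian) (h : Commute A T) (f : ℝ → ℝ) :
    Commute (cfc f A) T := by
  obtain ⟨p, hp⟩ := cfc_poly (d := d) f A.finite_real_spectrum.toFinset
  rw [hp A hA (by simp), Polynomial.aeval_eq_sum_range]
  exact Commute.sum_left _ _ _ fun i _ => (h.pow_left i).smul_left _

lemma matLog_mul {d : ℕ} {A B : Mt d} (hA : A.PosDef) (hB : B.PosDef) (h : Commute A B) :
    matLog (A * B) = matLog A + matLog B := by
  have sA : IsSelfAdjoint (CFC.log A) := IsSelfAdjoint.log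
  have sB : IsSelfAdjoint (CFC.log B) := IsSelfAdjoint.log
  have hc : Commute (CFC.log A) (CFC.log B) :=
    (cfc_comm hB.1 (cfc_comm hA.1 h Real.log).symm Real.log).symm
  have e : A * B = NormedSpace.exp (CFC.log A + CFC.log B) := by
    rw [Matrix.exp_add_of_commute _ _ hc, CFC.exp_log A hA.isStrictlyPositive,
      CFC.exp_log B hB.isStrictlyPositive]
  calc matLog (A * B) = CFC.log (A * B) := rfl
    _ = CFC.log A + CFC.log B := by rw [e, CFC.log_exp _ (sA.add sB)]
    _ = _ := rfl

lemma cfc_psd {d : ℕ} {A : Mt d} (hA : A.IsHermitian) (f : ℝ → ℝ) (hf : ∀ x, 0 ≤ f x) :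
    (cfc f A).PosSemidef := by
  obtain ⟨U, l, h1, h2, h3, -⟩ := eig hA
  rw [h3]
  apply PosSemidef.mul_mul_conjTranspose_same
  apply PosSemidef.diagonal
  intro i
  simpa using hf (l i)

end Logs

lemma tr_psd {d : ℕ} {A B : Mt d} (hA : A.PosSemidef) (hB : B.PosSemidef) :
    0 ≤ (A * B).trace := by
  obtain ⟨C, rfl⟩ := psd_fact hB
  rw [← mul_assoc, Matrix.trace_mul_comm, ← mul_assoc]
  exact (hA.mul_mul_conjTranspose_same C).trace_nonneg

lemma tr_psd_zero {d : ℕ} {A B : Mt d} (hA : A.PosSemidef) (hB : B.PosSemidef)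
    (h : (A * B).trace = 0) : A * B = 0 := by
  obtain ⟨C, rfl⟩ := psd_fact hB
  obtain ⟨D, rfl⟩ := psd_fact hA
  have : (D * Cᴴ)ᴴ * (D * Cᴴ) = C * (Dᴴ * D) * Cᴴ := by
    simp only [conjTranspose_mul, conjTranspose_conjTranspose, mul_assoc]
  have h2 : ((D * Cᴴ)ᴴ * (D * Cᴴ)).trace = 0 := by
    rw [this, mul_assoc, Matrix.trace_mul_comm C, mul_assoc (Dᴴ * D), h]
  have h3 := trace_conjTranspose_mul_self_eq_zero_iff.mp h2
  calc Dᴴ * D * (Cᴴ * C) = Dᴴ * (D * Cᴴ) * C := by simp only [mul_assoc]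
    _ = 0 := by rw [h3]; simp

lemma log_sing {d : ℕ} {r τ ρ : Mt d} (hr : r.PosSemidef) (hτ : τ.PosDef) (hc : Commute r τ)
    (hρ : ρ.PosSemidef) (hs : ∀ f : ℝ → ℝ, (ρ * cfc f r).trace = (r * cfc f r).trace) :
    ρ * matLog (r * τ) = ρ * (matLog r + matLog τ) := by
  have hsa : IsSelfAdjoint r := hr.1
  have cont : ∀ g : ℝ → ℝ, ContinuousOn g (spectrum ℝ r) :=
    fun g => r.finite_real_spectrum.continuousOn g
  set z := cfc (fun t : ℝ => if t = 0 then (1 : ℝ) else 0) r with hz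
  set s := cfc (fun t : ℝ => if t = 0 then (0 : ℝ) else 1) r with hsdef
  have hid : cfc (fun t : ℝ => t) r = r := cfc_id' ℝ r
  have rz : r * z = 0 := by
    conv_lhs => rw [← hid]
    rw [hz, ← cfc_mul _ _ r (cont _) (cont _), ← cfc_zero ℝ r]
    apply cfc_congr
    intro t _
    by_cases h : t = 0 <;> simp [h]
  have sr : s * r = r := by
    conv_lhs => rw [← hid]
    conv_rhs => rw [← hid]
    rw [hsdef, ← cfc_mul _ _ r (cont _) (cont _)]
    apply cfc_congr
    intro t _
    by_cases h : t = 0 <;> simp [h]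
  have sz : s * z = 0 := by
    rw [hz, hsdef, ← cfc_mul _ _ r (cont _) (cont _), ← cfc_zero ℝ r]
    apply cfc_congr
    intro t _
    by_cases h : t = 0 <;> simp [h]
  have s1 : s + z = 1 := by
    rw [hz, hsdef, ← cfc_add _ _ _ (cont _) (cont _), ← cfc_one ℝ r]
    apply cfc_congr
    intro t _
    by_cases h : t = 0 <;> simp [h]
  have rzd : r + z = cfc (fun t : ℝ => t + if t = 0 then (1 : ℝ) else 0) r := by
    rw [cfc_add _ _ _ (cont _) (cont _), hid]
  have hzp : z.PosSemidef := cfc_psd hr.1 _ fun x => by split_ifs <;> norm_num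
  have hA' : (r + z).PosDef := by
    obtain ⟨U, l, h1, h2, h3, h4, h5, -⟩ := eig hr.1
    rw [rzd, h3]
    have hU : IsUnit U := ⟨⟨U, Uᴴ, h2, h1⟩, rfl⟩
    have := (Matrix.IsUnit.posDef_star_right_conjugate_iff hU
      (x := diagonal (fun i => (((l i + if l i = 0 then (1 : ℝ) else 0) : ℝ) : ℂ)))).mpr
    apply this
    apply PosDef.diagonal
    intro i
    have := h5 hr i
    rw [Complex.zero_lt_real]
    split_ifs with h
    · linarith
    · have : 0 < l i := lt_of_le_of_ne this (Ne.symm h)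
      linarith
  have hzτ : Commute z τ := cfc_comm hr.1 hc _
  have hsτ : Commute s τ := cfc_comm hr.1 hc _
  have hsr : Commute s r := cfc_comm hr.1 (Commute.refl r) _
  have hlogA : matLog (r + z) = matLog r := by
    rw [rzd, matLog, ← cfc_comp _ _ r hsa ((r.finite_real_spectrum.image _).continuousOn _)
      (cont _), matLog]
    apply cfc_congr
    intro t _
    by_cases h : t = 0 <;> simp [h]
  have hlogB := matLog_mul hA' hτ (hc.add_left hzτ)
  rw [← hlogA, ← hlogB]
  have ρz : ρ * z = 0 := by
    apply tr_psd_zero hρ hzp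
    rw [hs, rz, trace_zero]
  have ρs : ρ * s = ρ := by
    have : ρ * (s + z) = ρ := by rw [s1, mul_one]
    rwa [mul_add, ρz, add_zero] at this
  have hB := pd_mul_comm hA' hτ (hc.add_left hzτ)
  have hC := psd_mul_comm hr hτ.posSemidef hc
  have hsC : Commute s (r * τ) := hsr.mul_right hsτ
  have sB : s * ((r + z) * τ) = s * (r * τ) := by
    rw [← mul_assoc, mul_add, sz, add_zero, mul_assoc]
  have pw : ∀ n : ℕ, s * ((r + z) * τ) ^ n = s * (r * τ) ^ n := by
    intro n
    induction n with
    | zero => simp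
    | succ n ih =>
      rw [pow_succ, ← mul_assoc, ih, (hsC.pow_right n).eq, mul_assoc, sB, ← mul_assoc,
        ← (hsC.pow_right n).eq, mul_assoc, ← pow_succ]
  obtain ⟨p, hp⟩ := cfc_poly (d := d) Real.log (((r + z) * τ).finite_real_spectrum.toFinset ∪
    (r * τ).finite_real_spectrum.toFinset)
  rw [matLog, matLog, hp _ hB.1 (by simp), hp _ hC.1 (by simp), ← ρs, mul_assoc, mul_assoc]
  congr 1
  simp only [Polynomial.aeval_eq_sum_range, Finset.mul_sum, mul_smul_comm, pw]

lemma tr_vec {d : ℕ} (A : Mt d) (x : Fin d → ℂ) :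
    (A * vecMulVec x (star x)).trace = star x ⬝ᵥ (A *ᵥ x) := by
  rw [mul_vecMulVec, trace_vecMulVec, dotProduct_comm]

lemma tr_ext {d : ℕ} {A B : Mt d} (h : ∀ Y, (A * Y).trace = (B * Y).trace) : A = B :=
  Matrix.ext_iff_trace_mul_right.mpr h

namespace IsCE
variable {d : ℕ} {N : StarSubalgebra ℂ (Mt d)} {E Es : Mt d →ₗ[ℂ] Mt d}

lemma es_left (h : IsCE N E) (hs : ∀ X Y, (Es X * Y).trace = (X * E Y).trace) {a : Mt d}
    (ha : a ∈ N) (X : Mt d) : Es (a * X) = a * Es X := by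
  apply tr_ext
  intro Y
  rw [hs, mul_assoc, Matrix.trace_mul_comm, mul_assoc, ← h.right_mul ha, ← hs, ← mul_assoc,
    Matrix.trace_mul_comm, mul_assoc]

lemma es_right (h : IsCE N E) (hs : ∀ X Y, (Es X * Y).trace = (X * E Y).trace) {a : Mt d}
    (ha : a ∈ N) (X : Mt d) : Es (X * a) = Es X * a := by
  apply tr_ext
  intro Y
  rw [hs, mul_assoc, ← h.left_mul ha, ← hs, mul_assoc]

lemma es_star (h : IsCE N E) (hs : ∀ X Y, (Es X * Y).trace = (X * E Y).trace) (X : Mt d) :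
    Es Xᴴ = (Es X)ᴴ := by
  apply tr_ext
  intro Y
  have e := hs X Yᴴ
  have e2 := congrArg star e
  rw [← trace_conjTranspose, ← trace_conjTranspose, conjTranspose_mul, conjTranspose_mul,
    h.star_map, conjTranspose_conjTranspose, conjTranspose_conjTranspose] at e2
  rw [hs, Matrix.trace_mul_comm, ← e2, Matrix.trace_mul_comm]

lemma es_psd (h : IsCE N E) (hs : ∀ X Y, (Es X * Y).trace = (X * E Y).trace) {X : Mt d}
    (hX : X.PosSemidef) : (Es X).PosSemidef := by
  apply PosSemidef.of_dotProduct_mulVec_nonneg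
  · rw [IsHermitian, ← es_star h hs, hX.1.eq]
  · intro x
    rw [← tr_vec, hs]
    exact tr_psd hX (h.pos _ (posSemidef_vecMulVec_self_star x))

lemma es_pd (h : IsCE N E) (hs : ∀ X Y, (Es X * Y).trace = (X * E Y).trace) {σ : Mt d}
    (hσ : σ.PosDef) (hinv : ∀ X, (σ * E X).trace = (σ * X).trace) {X : Mt d}
    (hX : X.PosDef) : (Es X).PosDef := by
  apply PosDef.of_dotProduct_mulVec_pos
  · rw [IsHermitian, ← es_star h hs, hX.1.eq]
  · intro x hx
    have hp := h.pos _ (posSemidef_vecMulVec_self_star x)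
    rw [← tr_vec, hs]
    refine lt_of_le_of_ne (tr_psd hX.posSemidef hp) fun h0 => ?_
    have h1 := tr_psd_zero hX.posSemidef hp h0.symm
    have h2 : E (vecMulVec x (star x)) = 0 := by
      have := hX.isUnit.mul_left_cancel (h1.trans (mul_zero X).symm)
      exact this
    have h3 := hinv (vecMulVec x (star x))
    rw [h2, mul_zero, trace_zero, tr_vec] at h3
    exact (hσ.dotProduct_mulVec_pos hx).ne h3

lemma exists_density (N : StarSubalgebra ℂ (Mt d)) (ρ : Mt d) :
    ∃ r ∈ N, ∀ a ∈ N, (r * a).trace = (ρ * a).trace := by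
  let S : Submodule ℂ (Mt d) := Subalgebra.toSubmodule N.toSubalgebra
  have hS : ∀ x, x ∈ S ↔ x ∈ N := fun x => Iff.rfl
  let B : Mt d →ₗ[ℂ] Module.Dual ℂ S :=
    LinearMap.mk₂ ℂ (fun (a : Mt d) (b : S) => (a * (b : Mt d)).trace)
      (by intros; simp [add_mul]) (by intros; simp) (by intros; simp [mul_add]) (by intros; simp)
  let T : S →ₗ[ℂ] Module.Dual ℂ S := B.comp S.subtype
  have inj : Function.Injective T := by
    rw [← LinearMap.ker_eq_bot, LinearMap.ker_eq_bot']
    intro a ha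
    have hast : (a : Mt d)ᴴ ∈ S := by
      rw [hS]; exact star_mem ((hS _).mp a.2)
    have := congrArg (fun f => f ⟨_, hast⟩) ha
    have t : ((a : Mt d) * (a : Mt d)ᴴ).trace = 0 := this
    exact Subtype.ext (trace_mul_conjTranspose_self_eq_zero_iff.mp t)
  have sur : Function.Surjective T :=
    (LinearMap.injective_iff_surjective_of_finrank_eq_finrank
      (Subspace.dual_finrank_eq).symm).mp inj
  obtain ⟨r, hr⟩ := sur (B ρ)
  refine ⟨r, (hS _).mp r.2, fun a ha => ?_⟩
  exact congrArg (fun f => f ⟨a, (hS _).mpr ha⟩) hr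

lemma es_dec (h : IsCE N E) (hs : ∀ X Y, (Es X * Y).trace = (X * E Y).trace) {σ : Mt d}
    (hσ : σ.PosDef) (hinv : ∀ X, (σ * E X).trace = (σ * X).trace) {ρ : Mt d}
    (hρ : ρ.PosSemidef) :
    ∃ r ∈ N, (∀ a ∈ N, (r * a).trace = (ρ * a).trace) ∧ Es ρ = r * Es 1 ∧ Commute r (Es 1) ∧
      r.PosSemidef ∧ (ρ.PosDef → r.PosDef) := by
  obtain ⟨r, hr, hra⟩ := exists_density N ρ
  have hτ := es_pd h hs hσ hinv PosDef.one
  have e0 : Es ρ = Es r := by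
    apply tr_ext
    intro Y
    rw [hs, hs, hra _ (h.range Y)]
  have e1 : Es ρ = r * Es 1 := by rw [e0, ← es_left h hs hr, mul_one]
  have e2 : Es ρ = Es 1 * r := by rw [e0, ← es_right h hs hr, one_mul]
  have hc : Commute r (Es 1) := e1.symm.trans e2
  have hdet : IsUnit (Es 1).det := (Matrix.isUnit_iff_isUnit_det _).mp hτ.isUnit
  have e3 : r = Es ρ * (Es 1)⁻¹ := by
    rw [e1, mul_assoc, Matrix.mul_nonsing_inv _ hdet, mul_one]
  have hc2 : Commute (Es ρ) (Es 1)⁻¹ := by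
    rw [Commute, SemiconjBy, ← e3, e2, ← mul_assoc, Matrix.nonsing_inv_mul _ hdet, one_mul]
  refine ⟨r, hr, hra, e1, hc, ?_, ?_⟩
  · rw [e3]
    exact psd_mul_comm (es_psd h hs hρ) hτ.inv.posSemidef hc2
  · intro hpd
    rw [e3]
    exact pd_mul_comm (es_pd h hs hσ hinv hpd) hτ.inv hc2

/-- the chain rule ingredient -/
lemma chain (h : IsCE N E) (hs : ∀ X Y, (Es X * Y).trace = (X * E Y).trace) {σ : Mt d}
    (hσ : σ.PosDef) (hinv : ∀ X, (σ * E X).trace = (σ * X).trace) {ρ ω : Mt d}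
    (hρ : ρ.PosDef) (hω : ω.PosDef) :
    relEnt (Es ρ) (Es ω) = (ρ * (matLog (Es ρ) - matLog (Es ω))).trace.re := by
  obtain ⟨r, hr, -, r1, r2, -, r3⟩ := es_dec h hs hσ hinv hρ.posSemidef
  obtain ⟨w, hw, -, w1, w2, -, w3⟩ := es_dec h hs hσ hinv hω.posSemidef
  have hτ := es_pd h hs hσ hinv PosDef.one
  have e : matLog (Es ρ) - matLog (Es ω) = matLog r - matLog w := by
    rw [r1, w1, matLog_mul (r3 hρ) hτ r2, matLog_mul (w3 hω) hτ w2]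
    abel
  have m : matLog r - matLog w ∈ N :=
    sub_mem (cfc_mem (r3 hρ).1 hr _) (cfc_mem (w3 hω).1 hw _)
  rw [relEnt, e, hs, h.id _ m]

/-- entropy formula, valid for singular `ρ` too -/
lemma formula (h : IsCE N E) (hs : ∀ X Y, (Es X * Y).trace = (X * E Y).trace) {σ : Mt d}
    (hσ : σ.PosDef) (hinv : ∀ X, (σ * E X).trace = (σ * X).trace) {ρ : Mt d}
    (hρ : ρ.PosSemidef) : ∃ r : Mt d, r.PosSemidef ∧ ∀ ε : ℝ, 0 ≤ ε →
      relEnt (ρ + (ε : ℂ) • 1) (Es (ρ + (ε : ℂ) • 1)) =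
        ((ρ + (ε : ℂ) • 1) * matLog (ρ + (ε : ℂ) • 1)).trace.re
        - ((r + (ε : ℂ) • 1) * matLog (r + (ε : ℂ) • 1)).trace.re
        - ((ρ + (ε : ℂ) • 1) * matLog (Es 1)).trace.re := by
  obtain ⟨r, hr, hra, r1, r2, r3, -⟩ := es_dec h hs hσ hinv hρ
  have hτ := es_pd h hs hσ hinv PosDef.one
  refine ⟨r, r3, fun ε hε => ?_⟩
  have hε1 : ((ε : ℂ) • (1 : Mt d)).PosSemidef :=
    PosSemidef.smul PosSemidef.one (by simpa using hε)
  have hρ' := hρ.add hε1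
  have hr' := r3.add hε1
  have hrN : r + (ε : ℂ) • 1 ∈ N := add_mem hr (N.smul_mem (one_mem N) _)
  have hra' : ∀ a ∈ N, ((r + (ε : ℂ) • 1) * a).trace = ((ρ + (ε : ℂ) • 1) * a).trace := by
    intro a ha
    rw [add_mul, add_mul, trace_add, trace_add, hra a ha]
  have hes : Es (ρ + (ε : ℂ) • 1) = (r + (ε : ℂ) • 1) * Es 1 := by
    rw [map_add, map_smul, r1, add_mul, smul_mul_assoc, one_mul]
  have hc : Commute (r + (ε : ℂ) • 1) (Es 1) :=
    r2.add_left ((Commute.one_left _).smul_left _)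
  have L := log_sing hr' hτ hc hρ' fun f => (hra' _ (cfc_mem hr'.1 hrN f)).symm
  have m := hra' _ (cfc_mem hr'.1 hrN Real.log)
  rw [relEnt, mul_sub, trace_sub, hes, L, mul_add, trace_add, Complex.sub_re, Complex.add_re]
  rw [show matLog (r + (ε : ℂ) • 1) = cfc Real.log (r + (ε : ℂ) • 1) from rfl, m]
  ring

end IsCE

section calculus
open Filter Topology

lemma der_log {ι : Type*} [Fintype ι] (c p w : ι → ℝ) (hp : ∀ i, 0 < p i) (hw : ∀ i, 0 < w i)
    (t : ℝ) (ht : 0 ≤ t) : HasDerivAt (fun t => ∑ i, c i * p i * Real.log (w i + t * p i))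
        (∑ i, c i * (p i ^ 2 / (w i + t * p i))) t := by
  apply HasDerivAt.fun_sum
  intro i _
  have hpos : 0 < w i + t * p i := by have := hp i; have := hw i; positivity
  have h1 : HasDerivAt (fun t => w i + t * p i) (p i) t := by
    simpa using ((hasDerivAt_id t).mul_const (p i)).const_add (w i)
  have h2 := (h1.log hpos.ne').const_mul (c i * p i)
  refine h2.congr_deriv ?_
  field_simp

lemma lim_log {ι : Type*} [Fintype ι] (c p w : ι → ℝ) (hp : ∀ i, 0 < p i) (hw : ∀ i, 0 < w i) :
    Tendsto (fun t => ∑ i, c i * p i * Real.log (w i + t * p i) - (∑ i, c i * p i) * Real.log t)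
      atTop (𝓝 (∑ i, c i * p i * Real.log (p i))) := by
  have h1 : Tendsto (fun t : ℝ => ∑ i, c i * p i * Real.log (w i / t + p i)) atTop
      (𝓝 (∑ i, c i * p i * Real.log (p i))) := by
    apply tendsto_finsetSum
    intro i _
    have h2 : Tendsto (fun t : ℝ => w i / t + p i) atTop (𝓝 (p i)) := by
      simpa using (tendsto_const_nhds.div_atTop tendsto_id).add
        (tendsto_const_nhds (x := p i))
    exact (h2.log (hp i).ne').const_mul _
  refine h1.congr' ?_
  filter_upwards [eventually_gt_atTop 0] with t ht
  rw [Finset.sum_mul, ← Finset.sum_sub_distrib]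
  refine Finset.sum_congr rfl fun i _ => ?_
  have hpos : 0 < w i + t * p i := by have := hp i; have := hw i; positivity
  have : w i / t + p i = (w i + t * p i) / t := by field_simp
  rw [this, Real.log_div hpos.ne' ht.ne']
  ring

lemma calc_ineq {ι κ : Type*} [Fintype ι] [Fintype κ] (c p w : ι → ℝ) (c' p' w' : κ → ℝ)
    (hp : ∀ i, 0 < p i) (hw : ∀ i, 0 < w i) (hp' : ∀ i, 0 < p' i) (hw' : ∀ i, 0 < w' i)
    (hsum : ∑ i, c i * p i = ∑ i, c' i * p' i)
    (h : ∀ t : ℝ, 0 ≤ t → ∑ i, c' i * (p' i ^ 2 / (w' i + t * p' i)) ≤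
      ∑ i, c i * (p i ^ 2 / (w i + t * p i))) :
    ∑ i, c' i * p' i * (Real.log (p' i) - Real.log (w' i)) ≤
      ∑ i, c i * p i * (Real.log (p i) - Real.log (w i)) := by
  set F : ℝ → ℝ := fun t => ∑ i, c i * p i * Real.log (w i + t * p i) with hF
  set F' : ℝ → ℝ := fun t => ∑ i, c' i * p' i * Real.log (w' i + t * p' i) with hF'
  have d1 : ∀ t, 0 ≤ t → HasDerivAt (fun t => F t - F' t) _ t := fun t ht =>
    (der_log c p w hp hw t ht).sub (der_log c' p' w' hp' hw' t ht)
  have mono : MonotoneOn (fun t => F t - F' t) (Set.Ici 0) := by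
    apply monotoneOn_of_deriv_nonneg (convex_Ici 0)
    · intro t ht
      exact (d1 t ht).continuousAt.continuousWithinAt
    · intro t ht
      rw [interior_Ici] at ht
      exact (d1 t (le_of_lt ht)).differentiableAt.differentiableWithinAt
    · intro t ht
      rw [interior_Ici] at ht
      rw [(d1 t (le_of_lt ht)).deriv]
      exact sub_nonneg.mpr (h t (le_of_lt ht))
  have l := (lim_log c p w hp hw).sub (lim_log c' p' w' hp' hw')
  have l2 : F 0 - F' 0 ≤ ∑ i, c i * p i * Real.log (p i) - ∑ i, c' i * p' i * Real.log (p' i) := by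
    refine ge_of_tendsto l ?_
    filter_upwards [eventually_ge_atTop 0] with t ht
    have := mono Set.self_mem_Ici ht ht
    simp only [hF, hF'] at this ⊢
    rw [hsum]
    linarith
  simp only [hF, hF', zero_mul, add_zero] at l2
  simp only [mul_sub, Finset.sum_sub_distrib]
  linarith
end calculus

section qrep

def Gf {d : ℕ} (ρ ω : Mt d) (t : ℝ) (X : Mt d) : ℝ :=
  2 * (ρ * X).trace.re - (ω * (X * Xᴴ)).trace.re - t * (ρ * (Xᴴ * X)).trace.re

lemma tr_diag {d : ℕ} (a : Fin d → ℂ) (M : Mt d) :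
    (diagonal a * M).trace = ∑ i, a i * M i i := by
  simp [Matrix.trace, diagonal_mul]

lemma tr_pair {d : ℕ} (U V : Mt d) (a b : Fin d → ℝ) :
    ((U * diagonal (fun i => (a i : ℂ)) * Uᴴ) * (V * diagonal (fun i => (b i : ℂ)) * Vᴴ)).trace
      = ((∑ x : Fin d × Fin d, Complex.normSq ((Uᴴ * V) x.1 x.2) * a x.1 * b x.2 : ℝ) : ℂ) := by
  have e : ((U * diagonal (fun i => (a i : ℂ)) * Uᴴ) * (V * diagonal (fun i => (b i : ℂ)) * Vᴴ)).trace
      = (diagonal (fun i => (a i : ℂ)) * ((Uᴴ * V) * diagonal (fun i => (b i : ℂ)) * (Uᴴ * V)ᴴ)).trace := by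
    rw [conjTranspose_mul, conjTranspose_conjTranspose, mul_assoc, mul_assoc, Matrix.trace_mul_comm]
    simp only [mul_assoc]
  rw [e, tr_diag, Fintype.sum_prod_type]
  push_cast
  refine Finset.sum_congr rfl fun i _ => ?_
  rw [mul_apply, Finset.mul_sum]
  refine Finset.sum_congr rfl fun j _ => ?_
  rw [mul_diagonal, conjTranspose_apply, Complex.normSq_eq_conj_mul_self]
  simp only [RCLike.star_def]
  ring

lemma tr_YY {d : ℕ} (a : Fin d → ℝ) (Y : Mt d) :
    (diagonal (fun i => (a i : ℂ)) * (Y * Yᴴ)).trace.re = ∑ j, ∑ i, a j * Complex.normSq (Y j i) := by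
  rw [tr_diag, Complex.re_sum]
  refine Finset.sum_congr rfl fun i _ => ?_
  rw [Complex.re_ofReal_mul, mul_apply, Complex.re_sum, Finset.mul_sum]
  refine Finset.sum_congr rfl fun j _ => ?_
  rw [conjTranspose_apply, RCLike.star_def, Complex.mul_conj, Complex.ofReal_re]

lemma Gf_eq {d : ℕ} (U V : Mt d) (hU : Uᴴ * U = 1) (hV : Vᴴ * V = 1) (p w : Fin d → ℝ) (t : ℝ)
    (Y : Mt d) :
    Gf (U * diagonal (fun i => (p i : ℂ)) * Uᴴ) (V * diagonal (fun i => (w i : ℂ)) * Vᴴ) t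
      (V * Y * Uᴴ) = ∑ x : Fin d × Fin d, (2 * p x.1 * ((Uᴴ * V) x.1 x.2 * Y x.2 x.1).re
        - (w x.2 + t * p x.1) * Complex.normSq (Y x.2 x.1)) := by
  have k : ∀ M Q Z : Mt d, Q ᴴ * Q = 1 → Qᴴ * (Q * Z) = Z := by
    intro M Q Z h; rw [← mul_assoc, h, one_mul]
  have e1 : (U * diagonal (fun i => (p i : ℂ)) * Uᴴ * (V * Y * Uᴴ)).trace
      = (diagonal (fun i => (p i : ℂ)) * ((Uᴴ * V) * Y)).trace := by
    rw [mul_assoc, mul_assoc, Matrix.trace_mul_comm]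
    simp only [mul_assoc, hU, mul_one]
  have e2 : (V * diagonal (fun i => (w i : ℂ)) * Vᴴ * ((V * Y * Uᴴ) * (V * Y * Uᴴ)ᴴ)).trace
      = (diagonal (fun i => (w i : ℂ)) * (Y * Yᴴ)).trace := by
    rw [mul_assoc, mul_assoc, Matrix.trace_mul_comm]
    simp only [conjTranspose_mul, conjTranspose_conjTranspose, mul_assoc]
    simp only [hV, mul_one, k 1 V _ hV, k 1 U _ hU]
  have e3 : (U * diagonal (fun i => (p i : ℂ)) * Uᴴ * ((V * Y * Uᴴ)ᴴ * (V * Y * Uᴴ))).trace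
      = (diagonal (fun i => (p i : ℂ)) * (Yᴴ * Yᴴᴴ)).trace := by
    rw [mul_assoc, mul_assoc, Matrix.trace_mul_comm]
    simp only [conjTranspose_mul, conjTranspose_conjTranspose, mul_assoc]
    simp only [hU, mul_one, k 1 V _ hV, k 1 U _ hU]
  rw [Gf, e1, e2, e3, tr_YY, tr_YY, tr_diag, Complex.re_sum]
  conv_lhs => arg 1; arg 2; rw [Finset.sum_comm]
  rw [Fintype.sum_prod_type, Finset.mul_sum, Finset.mul_sum, ← Finset.sum_sub_distrib,
    ← Finset.sum_sub_distrib]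
  refine Finset.sum_congr rfl fun i _ => ?_
  rw [Complex.re_ofReal_mul, mul_apply, Complex.re_sum, Finset.mul_sum, Finset.mul_sum,
    Finset.mul_sum, ← Finset.sum_sub_distrib, ← Finset.sum_sub_distrib]
  refine Finset.sum_congr rfl fun j _ => ?_
  rw [conjTranspose_apply, RCLike.star_def, Complex.normSq_conj]
  ring

lemma pt_le (p s : ℝ) (hs : 0 < s) (a y : ℂ) :
    2 * p * (a * y).re - s * Complex.normSq y ≤ Complex.normSq a * (p ^ 2 / s) := by
  rw [← mul_div_assoc, le_div_iff₀ hs]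
  simp only [Complex.normSq_apply, Complex.mul_re]
  nlinarith [sq_nonneg (p * a.re - s * y.re), sq_nonneg (p * a.im + s * y.im)]

lemma pt_eq (p s : ℝ) (hs : 0 < s) (a : ℂ) :
    2 * p * (a * (((p / s : ℝ) : ℂ) * star a)).re - s * Complex.normSq (((p / s : ℝ) : ℂ) * star a)
      = Complex.normSq a * (p ^ 2 / s) := by
  simp only [Complex.normSq_apply, Complex.mul_re, Complex.mul_im, Complex.ofReal_re,
    Complex.ofReal_im, RCLike.star_def, Complex.conj_re, Complex.conj_im]
  field_simp
  ring

lemma qrep {d : ℕ} {ρ ω : Mt d} (hρ : ρ.PosDef) (hω : ω.PosDef) :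
    ∃ c p w : Fin d × Fin d → ℝ, (∀ i, 0 < p i) ∧ (∀ i, 0 < w i) ∧
      relEnt ρ ω = ∑ i, c i * p i * (Real.log (p i) - Real.log (w i)) ∧
      ρ.trace.re = ∑ i, c i * p i ∧
      (∀ t, 0 ≤ t → ∀ X, Gf ρ ω t X ≤ ∑ i, c i * (p i ^ 2 / (w i + t * p i))) ∧
      (∀ t, 0 ≤ t → ∃ X, Gf ρ ω t X = ∑ i, c i * (p i ^ 2 / (w i + t * p i))) := by
  obtain ⟨U, p, hU, hU', cU, eU, -, pU⟩ := eig hρ.1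
  obtain ⟨V, w, hV, hV', cV, eV, -, pV⟩ := eig hω.1
  have hp := pU hρ
  have hw := pV hω
  have one : (1 : Mt d) = V * diagonal (fun i => (((fun _ => 1 : Fin d → ℝ) i : ℝ) : ℂ)) * Vᴴ := by
    simp [hV']
  refine ⟨fun x => Complex.normSq ((Uᴴ * V) x.1 x.2), fun x => p x.1, fun x => w x.2,
    fun x => hp _, fun x => hw _, ?_, ?_, ?_, ?_⟩
  · have a1 : (ρ * matLog ρ).trace.re
        = ∑ x : Fin d × Fin d, Complex.normSq ((Uᴴ * V) x.1 x.2) * (p x.1 * Real.log (p x.1)) := by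
      have : ρ * matLog ρ = (U * diagonal (fun i => ((p i * Real.log (p i) : ℝ) : ℂ)) * Uᴴ)
          * (V * diagonal (fun i => (((fun _ => 1 : Fin d → ℝ) i : ℝ) : ℂ)) * Vᴴ) := by
        rw [← one, mul_one, matLog, cU, eU]
        have : ∀ D D' : Mt d, (U * D * Uᴴ) * (U * D' * Uᴴ) = U * (D * D') * Uᴴ := by
          intro D D'
          calc _ = U * D * (Uᴴ * U) * D' * Uᴴ := by simp only [mul_assoc]
            _ = _ := by rw [hU]; simp only [mul_assoc, mul_one, one_mul]
        rw [this, diagonal_mul_diagonal]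
        push_cast
        rfl
      rw [this, tr_pair, Complex.ofReal_re]
      simp
    have a2 : (ρ * matLog ω).trace.re
        = ∑ x : Fin d × Fin d, Complex.normSq ((Uᴴ * V) x.1 x.2) * p x.1 * Real.log (w x.2) := by
      rw [matLog, cV]
      conv_lhs => rw [eU]
      rw [tr_pair, Complex.ofReal_re]
    rw [relEnt, mul_sub, trace_sub, Complex.sub_re, a1, a2, ← Finset.sum_sub_distrib]
    refine Finset.sum_congr rfl fun x _ => ?_
    ring
  · rw [← mul_one ρ, one]
    conv_lhs => rw [eU]
    rw [tr_pair, Complex.ofReal_re]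
    simp
  · intro t ht X
    have hX : X = V * (Vᴴ * X * U) * Uᴴ := by
      calc X = (V * Vᴴ) * X * (U * Uᴴ) := by rw [hU', hV', one_mul, mul_one]
        _ = _ := by simp only [mul_assoc]
    rw [hX, eU, eV, Gf_eq U V hU hV]
    refine Finset.sum_le_sum fun x _ => pt_le _ _ ?_ _ _
    have := hp x.1; have := hw x.2; positivity
  · intro t ht
    refine ⟨V * (Matrix.of fun j i => ((p i / (w j + t * p i) : ℝ) : ℂ) * star ((Uᴴ * V) i j) : Mt d) * Uᴴ, ?_⟩
    rw [eU, eV, Gf_eq U V hU hV]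
    refine Finset.sum_congr rfl fun x _ => pt_eq _ _ ?_ _
    have := hp x.1; have := hw x.2; positivity

end qrep

namespace IsCE
variable {d : ℕ} {N : StarSubalgebra ℂ (Mt d)} {E Es : Mt d →ₗ[ℂ] Mt d}

lemma dpi (h : IsCE N E) (hs : ∀ X Y, (Es X * Y).trace = (X * E Y).trace) {σ : Mt d}
    (hσ : σ.PosDef) (hinv : ∀ X, (σ * E X).trace = (σ * X).trace) {ρ ω : Mt d}
    (hρ : ρ.PosDef) (hω : ω.PosDef) : relEnt (Es ρ) (Es ω) ≤ relEnt ρ ω := by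
  obtain ⟨c, p, w, hp, hw, e, et, le, -⟩ := qrep hρ hω
  obtain ⟨c', p', w', hp', hw', e', et', -, ex⟩ :=
    qrep (h.es_pd hs hσ hinv hρ) (h.es_pd hs hσ hinv hω)
  rw [e, e']
  apply calc_ineq c p w c' p' w' hp hw hp' hw'
  · rw [← et, ← et']
    have := hs ρ 1
    rw [h.unital, mul_one, mul_one] at this
    rw [this]
  · intro t ht
    obtain ⟨X, hX⟩ := ex t ht
    rw [← hX]
    refine le_trans ?_ (le t ht (E X))
    rw [Gf, Gf, hs, hs, hs]
    have s1 := tr_psd hρ.posSemidef (h.schwarz X)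
    have s2 := tr_psd hω.posSemidef (h.schwarz Xᴴ)
    rw [conjTranspose_conjTranspose, h.star_map, conjTranspose_conjTranspose] at s2
    rw [mul_sub, trace_sub] at s1 s2
    have r1 := (Complex.le_def.mp s1).1
    have r2 := (Complex.le_def.mp s2).1
    simp only [Complex.zero_re, Complex.sub_re] at r1 r2
    have r3 := mul_nonneg ht r1
    linarith

end IsCE

lemma main_pd {d : ℕ} {M N1 N2 : StarSubalgebra ℂ (Mt d)} {EM E1 E2 EMs E1s E2s : Mt d →ₗ[ℂ] Mt d}
    (h1 : IsCE N1 E1) (h2 : IsCE N2 E2)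
    (hMs : ∀ X Y, (EMs X * Y).trace = (X * EM Y).trace)
    (h1s : ∀ X Y, (E1s X * Y).trace = (X * E1 Y).trace)
    (h2s : ∀ X Y, (E2s X * Y).trace = (X * E2 Y).trace)
    (hcomm : ∀ X, E2 (E1 X) = EM X) {σ : Mt d} (hσ : σ.PosDef)
    (hinv1 : ∀ X, (σ * E1 X).trace = (σ * X).trace)
    (hinv2 : ∀ X, (σ * E2 X).trace = (σ * X).trace) {ρ : Mt d} (hρ : ρ.PosDef) :
    relEnt ρ (EMs ρ) ≤ relEnt ρ (E1s ρ) + relEnt ρ (E2s ρ) := by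
  have e : EMs ρ = E1s (E2s ρ) := by
    apply tr_ext
    intro Y
    rw [hMs, h1s, h2s, hcomm]
  have hω := h2.es_pd h2s hσ hinv2 hρ
  have c := h1.chain h1s hσ hinv1 hρ hω
  have D := h1.dpi h1s hσ hinv1 hρ hω
  rw [c] at D
  rw [e]
  simp only [relEnt, mul_sub, trace_sub, Complex.sub_re] at D ⊢
  linarith

section limit
open Filter Topology

lemma ent_tendsto {d : ℕ} {A : Mt d} (hA : A.PosSemidef) :
    Tendsto (fun ε : ℝ => ((A + (ε : ℂ) • (1 : Mt d)) * matLog (A + (ε : ℂ) • (1 : Mt d))).trace.re)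
      (𝓝 0) (𝓝 ((A + ((0 : ℝ) : ℂ) • (1 : Mt d)) * matLog (A + ((0 : ℝ) : ℂ) • (1 : Mt d))).trace.re) := by
  obtain ⟨U, l, hU, hU', cU, eU, -, -⟩ := eig hA.1
  have key : ∀ ε : ℝ, ((A + (ε : ℂ) • (1 : Mt d)) * matLog (A + (ε : ℂ) • (1 : Mt d))).trace.re
      = ∑ i, (l i + ε) * Real.log (l i + ε) := by
    intro ε
    have s : IsSelfAdjoint A := hA.1
    have fin : (spectrum ℝ A).Finite := Matrix.finite_real_spectrum
    have b1 : A + (ε : ℂ) • (1 : Mt d) = cfc (fun x : ℝ => x + ε) A := by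
      rw [cU]
      push_cast
      have : diagonal (fun i => ((l i : ℂ) + (ε : ℂ)))
          = diagonal (fun i => (l i : ℂ)) + (ε : ℂ) • (1 : Mt d) := by
        rw [smul_one_eq_diagonal, diagonal_add]
      rw [this, mul_add, add_mul, ← eU]
      simp [hU']
    have b2 : (A + (ε : ℂ) • (1 : Mt d)) * matLog (A + (ε : ℂ) • (1 : Mt d))
        = cfc (fun x : ℝ => (x + ε) * Real.log (x + ε)) A := by
      rw [matLog, b1, ← cfc_comp' Real.log (fun x : ℝ => x + ε) A
        ((fin.image _).continuousOn _) (fin.continuousOn _) s,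
        ← cfc_mul _ _ A (fin.continuousOn _) (fin.continuousOn _)]
    rw [b2, cU, mul_assoc, Matrix.trace_mul_comm, mul_assoc, hU, mul_one, trace_diagonal,
      Complex.re_sum]
    rfl
  simp only [key]
  apply Continuous.tendsto
  apply continuous_finsetSum
  intro i _
  exact Real.continuous_mul_log.comp (continuous_const.add continuous_id)

lemma rel_tendsto {d : ℕ} {N : StarSubalgebra ℂ (Mt d)} {E Es : Mt d →ₗ[ℂ] Mt d}
    (h : IsCE N E) (hs : ∀ X Y, (Es X * Y).trace = (X * E Y).trace) {σ : Mt d}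
    (hσ : σ.PosDef) (hinv : ∀ X, (σ * E X).trace = (σ * X).trace) {ρ : Mt d}
    (hρ : ρ.PosSemidef) :
    Tendsto (fun ε : ℝ => relEnt (ρ + (ε : ℂ) • (1 : Mt d)) (Es (ρ + (ε : ℂ) • (1 : Mt d))))
      (𝓝[>] 0) (𝓝 (relEnt ρ (Es ρ))) := by
  obtain ⟨r, hr, hf⟩ := h.formula hs hσ hinv hρ
  have e0 : relEnt ρ (Es ρ)
      = relEnt (ρ + ((0 : ℝ) : ℂ) • (1 : Mt d)) (Es (ρ + ((0 : ℝ) : ℂ) • (1 : Mt d))) := by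
    simp
  rw [e0, hf 0 le_rfl]
  have t3 : Tendsto (fun ε : ℝ => ((ρ + (ε : ℂ) • (1 : Mt d)) * matLog (Es 1)).trace.re) (𝓝 0)
      (𝓝 ((ρ + ((0 : ℝ) : ℂ) • (1 : Mt d)) * matLog (Es 1)).trace.re) := by
    apply Continuous.tendsto (f := fun ε : ℝ => ((ρ + (ε : ℂ) • (1 : Mt d)) * matLog (Es 1)).trace.re)
    simp only [add_mul, smul_mul_assoc, one_mul, trace_add, trace_smul, smul_eq_mul]
    fun_prop
  refine Tendsto.congr' ?_
    ((((ent_tendsto hρ).sub (ent_tendsto hr)).sub t3).mono_left nhdsWithin_le_nhds)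
  filter_upwards [self_mem_nhdsWithin] with ε hε
  rw [hf ε (le_of_lt hε)]

end limit

end Helpers


/-- If conditional expectations `E^M, E₁, E₂` onto `M ⊆ N₁, N₂ ⊆ N`,
compatible with a full-rank state `σ`, form a commuting square (`E₁∘E₂ = E₂∘E₁ = E^M`),
then for any density matrix `ρ` on `N` the SSA-type inequality
`D(ρ‖E^M_*(ρ)) ≤ D(ρ‖E₁_*(ρ)) + D(ρ‖E₂_*(ρ))` holds, where `E_*` denotes the
Hilbert–Schmidt adjoint. -/
theorem commuting_square_strong_subadditivity
    {d : ℕ} (Malg N1 N2 Nalg : StarSubalgebra ℂ (Matrix (Fin d) (Fin d) ℂ))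
    (hMN1 : Malg ≤ N1) (hMN2 : Malg ≤ N2) (hN1 : N1 ≤ Nalg) (hN2 : N2 ≤ Nalg)
    (σ : Matrix (Fin d) (Fin d) ℂ) (hσ : σ.PosDef) (hσtr : σ.trace = 1)
    (EM E1 E2 EMs E1s E2s : Matrix (Fin d) (Fin d) ℂ →ₗ[ℂ] Matrix (Fin d) (Fin d) ℂ)
    -- `EM`, `E1`, `E2` are conditional expectations onto `Malg`, `N1`, `N2`:
    (hEMrange : ∀ X, EM X ∈ Malg) (hE1range : ∀ X, E1 X ∈ N1) (hE2range : ∀ X, E2 X ∈ N2)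
    (hEMid : ∀ X ∈ Malg, EM X = X) (hE1id : ∀ X ∈ N1, E1 X = X) (hE2id : ∀ X ∈ N2, E2 X = X)
    (hEMunital : EM 1 = 1) (hE1unital : E1 1 = 1) (hE2unital : E2 1 = 1)
    (hEMpos : ∀ X : Matrix (Fin d) (Fin d) ℂ, X.PosSemidef → (EM X).PosSemidef)
    (hE1pos : ∀ X : Matrix (Fin d) (Fin d) ℂ, X.PosSemidef → (E1 X).PosSemidef)
    (hE2pos : ∀ X : Matrix (Fin d) (Fin d) ℂ, X.PosSemidef → (E2 X).PosSemidef)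
    -- compatibility with the full-rank state `σ`:
    (hEMσ : ∀ X, (σ * EM X).trace = (σ * X).trace)
    (hE1σ : ∀ X, (σ * E1 X).trace = (σ * X).trace)
    (hE2σ : ∀ X, (σ * E2 X).trace = (σ * X).trace)
    -- `EMs`, `E1s`, `E2s` are the Hilbert–Schmidt adjoints (coarse-graining maps):
    (hEMs : ∀ X Y, (EMs X * Y).trace = (X * EM Y).trace)
    (hE1s : ∀ X Y, (E1s X * Y).trace = (X * E1 Y).trace)
    (hE2s : ∀ X Y, (E2s X * Y).trace = (X * E2 Y).trace)
    -- the commuting square condition: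
    (hcomm12 : ∀ X, E1 (E2 X) = EM X) (hcomm21 : ∀ X, E2 (E1 X) = EM X)
    -- `ρ` is a density matrix:
    (ρ : Matrix (Fin d) (Fin d) ℂ) (hρ : ρ.PosSemidef) (hρtr : ρ.trace = 1) :
    relEnt ρ (EMs ρ) ≤ relEnt ρ (E1s ρ) + relEnt ρ (E2s ρ) := by
  have hM : IsCE Malg EM := ⟨hEMrange, hEMid, hEMunital, hEMpos⟩
  have h1 : IsCE N1 E1 := ⟨hE1range, hE1id, hE1unital, hE1pos⟩
  have h2 : IsCE N2 E2 := ⟨hE2range, hE2id, hE2unital, hE2pos⟩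
  refine le_of_tendsto_of_tendsto (rel_tendsto hM hEMs hσ hEMσ hρ)
    ((rel_tendsto h1 hE1s hσ hE1σ hρ).add (rel_tendsto h2 hE2s hσ hE2σ hρ)) ?_
  filter_upwards [self_mem_nhdsWithin] with ε hε
  have hpd : (ρ + (ε : ℂ) • (1 : Matrix (Fin d) (Fin d) ℂ)).PosDef := by
    refine PosDef.posSemidef_add hρ (PosDef.one.smul ?_)
    exact_mod_cast hε
  exact main_pd (M := Malg) h1 h2 hEMs hE1s hE2s hcomm21 hσ hE1σ hE2σ hpd


end
end

section
/- Let E : N → M be a conditional expectation compatible with a full-rank state σ (so E_*(σ) = σ), and for a state ρ define the generalized entropy Ent_{1,M}(X) := D(Γ_σ(X)‖E_*(Γ_σ(X))) for X = Γ_σ^{−1}(ρ). Then Ent_{1,M}(X) = inf over full-rank positive Y ∈ M of D_Lin(Γ_σ(X)‖Γ_σ(Y)), where D_Lin(A‖B) := Tr[A(log A − log B)] − Tr[A] + Tr[B], and the infimum is attained at Y = E(X). -/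
open Matrix ComplexOrder

noncomputable section

/-- Lindblad relative entropy `D_Lin(A‖B) := Tr[A(log A − log B)] − Tr[A] + Tr[B]`. -/
def DLin {d : ℕ} (A B : Matrix (Fin d) (Fin d) ℂ) : ℝ :=
  ((A * (matLog A - matLog B)).trace).re - (A.trace).re + (B.trace).re

def matSqrt {d : ℕ} (A : Matrix (Fin d) (Fin d) ℂ) : Matrix (Fin d) (Fin d) ℂ :=
  cfc Real.sqrt A

def matInvSqrt {d : ℕ} (A : Matrix (Fin d) (Fin d) ℂ) : Matrix (Fin d) (Fin d) ℂ :=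
  cfc (fun x : ℝ => (Real.sqrt x)⁻¹) A

/-- `Γ_σ(X) := σ^{1/2} X σ^{1/2}`. -/
def Gam {d : ℕ} (σ X : Matrix (Fin d) (Fin d) ℂ) : Matrix (Fin d) (Fin d) ℂ :=
  matSqrt σ * X * matSqrt σ

/-- `Γ_σ^{-1}(X) := σ^{-1/2} X σ^{-1/2}`. -/
def GamInv {d : ℕ} (σ X : Matrix (Fin d) (Fin d) ℂ) : Matrix (Fin d) (Fin d) ℂ :=
  matInvSqrt σ * X * matInvSqrt σ

theorem contR {d : ℕ} (f : ℝ → ℝ) (A : Matrix (Fin d) (Fin d) ℂ) : ContinuousOn f (spectrum ℝ A) :=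
  A.finite_real_spectrum.continuousOn f

theorem contC {d : ℕ} (f : ℂ → ℂ) (A : Matrix (Fin d) (Fin d) ℂ) : ContinuousOn f (spectrum ℂ A) :=
  A.finite_spectrum.continuousOn f

open scoped Matrix.Norms.L2Operator ComplexStarModule in
theorem joint_cfc {d : ℕ} {A B : Matrix (Fin d) (Fin d) ℂ} (hA : A.IsHermitian) (hB : B.IsHermitian)
   (hAB : A * B = B * A) (f g h k : ℝ → ℝ)
   (H : ∀ x ∈ spectrum ℝ A, ∀ y ∈ spectrum ℝ B, f (x * y) = g x + h x * k y) :
   cfc f (A * B) = cfc g A + cfc h A * cfc k B := by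
  obtain ⟨N, hN⟩ : ∃ N, N = A + Complex.I • B := ⟨_, rfl⟩
  have sA : IsSelfAdjoint A := hA
  have sB : IsSelfAdjoint B := hB
  have hr : (ℜ N : Matrix (Fin d) (Fin d) ℂ) = A := by
    subst hN
    rw [map_add, realPart_I_smul, sB.imaginaryPart]
    simp [sA.coe_realPart]
  have hi : (ℑ N : Matrix (Fin d) (Fin d) ℂ) = B := by
    subst hN
    rw [map_add, imaginaryPart_I_smul, sA.imaginaryPart]
    simp [sB.coe_realPart]
  have hn : IsStarNormal N := by
    constructor
    subst hN
    show _ * _ = _ * _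
    simp only [star_add, star_smul, sA.star_eq, sB.star_eq]
    simp [add_mul, mul_add, hAB]
    abel
  have e1 : ∀ f : ℝ → ℝ, cfc f A = cfc (fun z : ℂ => (f z.re : ℂ)) N := by
    intro f
    rw [← hr]
    exact (cfc_comp_re f N (contR _ _)).symm
  have e2 : ∀ f : ℝ → ℝ, cfc f B = cfc (fun z : ℂ => (f z.im : ℂ)) N := by
    intro f
    rw [← hi]
    exact (cfc_comp_im f N (contR _ _)).symm
  have e3 : A * B = cfc (fun z : ℂ => ((z.re * z.im : ℝ) : ℂ)) N := by
    conv_lhs => rw [← cfc_id' ℝ A, ← cfc_id' ℝ B, e1, e2]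
    rw [← cfc_mul _ _ N (contC _ _) (contC _ _)]
    simp
  have e4 : IsSelfAdjoint (A * B) := (sA.commute_iff sB).mp hAB
  rw [cfc_real_eq_complex f e4, e1, e1, e2, ← cfc_mul _ _ N (contC _ _) (contC _ _),
    ← cfc_add N _ _ (contC _ _) (contC _ _), e3, ← cfc_comp' (fun z : ℂ => ((f z.re : ℝ) : ℂ)) (fun z : ℂ => ((z.re * z.im : ℝ) : ℂ)) N
      (((N.finite_spectrum).image _).continuousOn _) (contC _ _) hn]
  refine cfc_congr fun z hz => ?_
  have h1 : z.re ∈ spectrum ℝ A := by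
    rw [← hr, spectrum_realPart' N]
    exact ⟨z, hz, rfl⟩
  have h2 : z.im ∈ spectrum ℝ B := by
    rw [← hi, spectrum_imaginaryPart' N]
    exact ⟨z, hz, rfl⟩
  simp only [Complex.ofReal_re]
  rw [H _ h1 _ h2]
  push_cast
  rfl

theorem spec_nonneg {d : ℕ} {A : Matrix (Fin d) (Fin d) ℂ} (hA : A.PosSemidef) {x : ℝ}
    (hx : x ∈ spectrum ℝ A) : 0 ≤ x := by
  rw [hA.1.spectrum_real_eq_range_eigenvalues] at hx
  obtain ⟨i, rfl⟩ := hx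
  exact hA.eigenvalues_nonneg i

theorem spec_pos {d : ℕ} {A : Matrix (Fin d) (Fin d) ℂ} (hA : A.PosDef) {x : ℝ}
    (hx : x ∈ spectrum ℝ A) : 0 < x := by
  rw [hA.1.spectrum_real_eq_range_eigenvalues] at hx
  obtain ⟨i, rfl⟩ := hx
  exact hA.eigenvalues_pos i

theorem cfc_one_h {d : ℕ} {A : Matrix (Fin d) (Fin d) ℂ} (hA : A.IsHermitian) : cfc (fun _ : ℝ => (1 : ℝ)) A = 1 :=
  cfc_const_one ℝ A hA.isSelfAdjoint

theorem cfc_id_h {d : ℕ} {A : Matrix (Fin d) (Fin d) ℂ} (hA : A.IsHermitian) : cfc (fun x : ℝ => x) A = A :=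
  cfc_id' ℝ A hA.isSelfAdjoint

theorem cfc_herm {d : ℕ} (A : Matrix (Fin d) (Fin d) ℂ) (f : ℝ → ℝ) : (cfc f A).IsHermitian :=
  cfc_predicate f A

theorem cfc_sqrt_mul {d : ℕ} {A B : Matrix (Fin d) (Fin d) ℂ} (hA : A.PosSemidef) (hB : B.PosSemidef)
   (hAB : A * B = B * A) : cfc Real.sqrt (A * B) = cfc Real.sqrt A * cfc Real.sqrt B := by
  rw [joint_cfc hA.1 hB.1 hAB Real.sqrt (fun _ => 0) Real.sqrt Real.sqrt]
  · simp
  · intro x hx y hy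
    rw [Real.sqrt_mul (spec_nonneg hA hx)]; simp

theorem cfc_log_mul {d : ℕ} {A B : Matrix (Fin d) (Fin d) ℂ} (hA : A.PosSemidef) (hB : B.PosDef)
   (hAB : A * B = B * A) : cfc Real.log (A * B) = cfc Real.log A + cfc (fun x : ℝ => if x = 0 then 0 else 1) A * cfc Real.log B := by
  apply joint_cfc hA.1 hB.1 hAB
  intro x hx y hy
  have := spec_pos hB hy
  by_cases h : x = 0
  · simp [h]
  · simp [h, Real.log_mul h this.ne']

theorem cfc_log_mul' {d : ℕ} {A B : Matrix (Fin d) (Fin d) ℂ} (hA : A.PosDef) (hB : B.PosDef)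
   (hAB : A * B = B * A) : cfc Real.log (A * B) = cfc Real.log A + cfc Real.log B := by
  rw [joint_cfc hA.1 hB.1 hAB Real.log Real.log (fun _ => 1) Real.log]
  · rw [cfc_one_h hA.1]; simp
  intro x hx y hy
  rw [Real.log_mul (spec_pos hA hx).ne' (spec_pos hB hy).ne']; simp

/-- trace of a product of two functional calculi -/
theorem trace_cfc_cfc {d : ℕ} {A B : Matrix (Fin d) (Fin d) ℂ} (hA : A.IsHermitian) (hB : B.IsHermitian) :
    ∃ w : Fin d → Fin d → ℝ, (∀ i j, 0 ≤ w i j) ∧ ∀ f g : ℝ → ℝ,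
      (cfc f A * cfc g B).trace = ((∑ i, ∑ j, f (hA.eigenvalues i) * g (hB.eigenvalues j) * w i j : ℝ) : ℂ) := by
  let U : Matrix (Fin d) (Fin d) ℂ := hA.eigenvectorUnitary
  let V : Matrix (Fin d) (Fin d) ℂ := hB.eigenvectorUnitary
  refine ⟨fun i j => Complex.normSq ((star U * V) i j), fun i j => Complex.normSq_nonneg _, fun f g => ?_⟩
  rw [hA.cfc_eq, hB.cfc_eq]
  simp only [Matrix.IsHermitian.cfc, Unitary.conjStarAlgAut_apply]
  change ((U * diagonal _ * star U) * (V * diagonal _ * star V)).trace = _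
  have : ((U * diagonal (RCLike.ofReal ∘ f ∘ hA.eigenvalues) * star U) * (V * diagonal (RCLike.ofReal ∘ g ∘ hB.eigenvalues) * star V)).trace
     = ((diagonal (RCLike.ofReal ∘ f ∘ hA.eigenvalues) * (star U * V)) * (diagonal (RCLike.ofReal ∘ g ∘ hB.eigenvalues) * star (star U * V))).trace := by
    rw [star_mul, star_star, Matrix.mul_assoc, Matrix.mul_assoc, Matrix.trace_mul_comm]
    simp only [Matrix.mul_assoc]
  rw [this]
  push_cast
  rw [Matrix.trace]
  refine Finset.sum_congr rfl fun i _ => ?_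
  rw [Matrix.diag_apply, Matrix.mul_apply]
  refine Finset.sum_congr rfl fun j _ => ?_
  rw [Matrix.diagonal_mul, Matrix.diagonal_mul, Matrix.star_apply, Complex.normSq_eq_conj_mul_self]
  simp
  ring

theorem klein {d : ℕ} {A B : Matrix (Fin d) (Fin d) ℂ} (hA : A.PosSemidef) (hB : B.PosDef) :
    0 ≤ (A * (cfc Real.log A - cfc Real.log B)).trace.re - A.trace.re + B.trace.re := by
  obtain ⟨w, hw, H⟩ := trace_cfc_cfc hA.1 hB.1
  have h1 := H (fun x => x * Real.log x) (fun _ => 1)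
  have h2 := H (fun x => x) Real.log
  have h3 := H (fun x => x) (fun _ => 1)
  have h4 := H (fun _ => 1) (fun x => x)
  rw [cfc_mul _ _ A (contR _ _) (contR _ _), cfc_one_h hB.1, cfc_id_h hA.1, mul_one] at h1
  rw [cfc_id_h hA.1] at h2
  rw [cfc_one_h hB.1, cfc_id_h hA.1, mul_one] at h3
  rw [cfc_one_h hA.1, cfc_id_h hB.1, one_mul] at h4
  rw [mul_sub, trace_sub, h1, h2, h3, h4]
  simp only [Complex.sub_re, Complex.ofReal_re, ← Finset.sum_sub_distrib, ← Finset.sum_add_distrib]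
  refine Finset.sum_nonneg fun i _ => Finset.sum_nonneg fun j _ => ?_
  set a := hA.1.eigenvalues i
  set b := hB.1.eigenvalues j
  have ha : 0 ≤ a := hA.eigenvalues_nonneg i
  have hb : 0 < b := hB.eigenvalues_pos j
  have key : 0 ≤ a * Real.log a - a * Real.log b - a + b := by
    rcases ha.eq_or_lt with h | h
    · rw [← h]; simp [hb.le]
    · have := Real.log_le_sub_one_of_pos (div_pos hb h)
      rw [Real.log_div hb.ne' h.ne'] at this
      have := mul_le_mul_of_nonneg_left this ha
      have e : a * (b / a - 1) = b - a := by field_simp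
      rw [e] at this
      nlinarith
  nlinarith [mul_nonneg key (hw i j)]

theorem trace_cfc_nonneg {d : ℕ} {A B : Matrix (Fin d) (Fin d) ℂ} (hA : A.IsHermitian) (hB : B.PosSemidef) (f : ℝ → ℝ)
    (hf : ∀ x ∈ spectrum ℝ A, 0 ≤ f x) : 0 ≤ (cfc f A * B).trace.re := by
  obtain ⟨w, hw, H⟩ := trace_cfc_cfc hA hB.1
  have h1 := H f (fun x => x)
  rw [cfc_id_h hB.1] at h1
  rw [h1, Complex.ofReal_re]
  refine Finset.sum_nonneg fun i _ => Finset.sum_nonneg fun j _ => mul_nonneg (mul_nonneg (hf _ ?_) (hB.eigenvalues_nonneg j)) (hw i j)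
  exact hA.eigenvalues_mem_spectrum_real i

theorem cfc_aeval_exists {d : ℕ} {A : Matrix (Fin d) (Fin d) ℂ} (hA : A.IsHermitian) (f : ℝ → ℝ) :
    ∃ P : Polynomial ℝ, cfc f A = Polynomial.aeval A P := by
  refine ⟨Lagrange.interpolate A.finite_real_spectrum.toFinset id f, ?_⟩
  rw [← cfc_polynomial _ A hA]
  refine cfc_congr fun x hx => ?_
  exact (Lagrange.eval_interpolate_at_node (v := id) f (Set.injOn_id _) (by simpa using hx)).symm

theorem mcfc_mem {d : ℕ} {M : StarSubalgebra ℂ (Matrix (Fin d) (Fin d) ℂ)} {A : Matrix (Fin d) (Fin d) ℂ} (hA : A.IsHermitian)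
    (hM : A ∈ M) (f : ℝ → ℝ) : cfc f A ∈ M := by
  obtain ⟨P, hP⟩ := cfc_aeval_exists hA f
  rw [hP, Polynomial.aeval_eq_sum_range]
  refine sum_mem fun i _ => ?_
  have : (P.coeff i) • A ^ i = ((P.coeff i : ℂ)) • A ^ i := by
    simp
  rw [this]
  exact M.smul_mem (pow_mem hM i) _

theorem cfc_comm_s14 {d : ℕ} {A B : Matrix (Fin d) (Fin d) ℂ} (h : A * B = B * A) (f : ℝ → ℝ) :
    cfc f A * B = B * cfc f A :=
  Commute.cfc_real (show Commute A B from h) f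

theorem psd_lin_s14 {d : ℕ} {C H : Matrix (Fin d) (Fin d) ℂ} (h : ∀ t : ℝ, (C + (t : ℂ) • H).PosSemidef) :
    H = 0 := by
  have hC : C.IsHermitian := by simpa using (h 0).1
  have hH : H.IsHermitian := by
    have := (h 1).1.sub hC
    simpa using this
  have key : ∀ s : ℝ, (((s : ℝ) : ℂ) • H).PosSemidef := by
    intro s
    have hs : (((s : ℝ) : ℂ) • H).IsHermitian := by
      unfold Matrix.IsHermitian
      rw [conjTranspose_smul, hH.eq]
      simp
    rw [posSemidef_iff_dotProduct_mulVec]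
    refine ⟨hs, fun x => ?_⟩
    have him := hs.im_star_dotProduct_mulVec_self x
    have hre : 0 ≤ (star x ⬝ᵥ (((s : ℝ) : ℂ) • H) *ᵥ x).re := by
      rw [smul_mulVec, dotProduct_smul, smul_eq_mul, Complex.re_ofReal_mul]
      have hq : ∀ t : ℝ, 0 ≤ (star x ⬝ᵥ C *ᵥ x).re + t * (star x ⬝ᵥ H *ᵥ x).re := by
        intro t
        have := (posSemidef_iff_dotProduct_mulVec.mp (h t)).2 x
        rw [add_mulVec, dotProduct_add, smul_mulVec, dotProduct_smul, smul_eq_mul] at this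
        have := (Complex.le_def.mp this).1
        rwa [Complex.add_re, Complex.re_ofReal_mul, Complex.zero_re] at this
      set c := (star x ⬝ᵥ C *ᵥ x).re
      set e := (star x ⬝ᵥ H *ᵥ x).re
      have he : e = 0 := by
        by_contra hne
        have := hq (-(c + 1) / e)
        rw [div_mul_cancel₀ _ hne] at this
        linarith
      rw [he, mul_zero]
    exact Complex.le_def.mpr ⟨hre, by simpa using him.symm⟩
  have h1 := key 1
  have h2 := key (-1)
  simp only [Complex.ofReal_one, one_smul, Complex.ofReal_neg, neg_smul] at h1 h2
  rw [← h1.trace_eq_zero_iff]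
  have a := h1.trace_nonneg
  have b := h2.trace_nonneg
  rw [trace_neg] at b
  exact le_antisymm (by simpa using b) a

/-- spectral projection -/
def sproj {d : ℕ} (A : Matrix (Fin d) (Fin d) ℂ) (x : ℝ) : Matrix (Fin d) (Fin d) ℂ :=
  cfc (fun y : ℝ => if y = x then 1 else 0) A

theorem sproj_herm {d : ℕ} (A : Matrix (Fin d) (Fin d) ℂ) (x : ℝ) : (sproj A x).IsHermitian :=
  cfc_herm _ _

theorem sproj_idem {d : ℕ} (A : Matrix (Fin d) (Fin d) ℂ) (x : ℝ) : sproj A x * sproj A x = sproj A x := by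
  unfold sproj
  rw [← cfc_mul _ _ A (contR _ _) (contR _ _)]
  refine cfc_congr fun y _ => ?_
  by_cases h : y = x <;> simp [h]

theorem proj_psd {d : ℕ} {p : Matrix (Fin d) (Fin d) ℂ} (h : p.IsHermitian) (h2 : p * p = p) : p.PosSemidef := by
  have := posSemidef_self_mul_conjTranspose p
  rwa [h.eq, h2] at this

theorem sproj_sum {d : ℕ} {A : Matrix (Fin d) (Fin d) ℂ} (f : ℝ → ℝ) :
    cfc f A = ∑ x ∈ A.finite_real_spectrum.toFinset, ((f x : ℝ) : ℂ) • sproj A x := by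
  have : ∀ x, ((f x : ℝ) : ℂ) • sproj A x = cfc (fun y : ℝ => f x * (if y = x then 1 else 0)) A := by
    intro x
    rw [cfc_const_mul _ _ A (contR _ _)]
    simp [sproj]
  simp_rw [this]
  rw [← cfc_sum _ A _ (fun i _ => contR _ _)]
  refine cfc_congr fun x hx => ?_
  simp only [Finset.sum_apply]
  rw [Finset.sum_eq_single x]
  · simp
  · intro b _ hb; simp [hb.symm]
  · intro h; simp at h; exact absurd hx h

structure PosUnital {d : ℕ} (E : Matrix (Fin d) (Fin d) ℂ →ₗ[ℂ] Matrix (Fin d) (Fin d) ℂ) : Prop where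
  unital : E 1 = 1
  pos : ∀ X : Matrix (Fin d) (Fin d) ℂ, X.PosSemidef → (E X).PosSemidef

theorem smul_herm {d : ℕ} {A : Matrix (Fin d) (Fin d) ℂ} (hA : A.IsHermitian) (t : ℝ) : ((t : ℂ) • A).IsHermitian := by
  unfold Matrix.IsHermitian
  rw [conjTranspose_smul, hA.eq]
  simp

theorem sum_herm {d : ℕ} {ι : Type*} (s : Finset ι) (A : ι → Matrix (Fin d) (Fin d) ℂ) (hA : ∀ i, (A i).IsHermitian) :
    (∑ i ∈ s, A i).IsHermitian := by
  unfold Matrix.IsHermitian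
  rw [conjTranspose_sum]
  exact Finset.sum_congr rfl fun i _ => hA i

theorem PosUnital.herm {d : ℕ} {E : Matrix (Fin d) (Fin d) ℂ →ₗ[ℂ] Matrix (Fin d) (Fin d) ℂ} (hE : PosUnital E)
    {A : Matrix (Fin d) (Fin d) ℂ} (hA : A.IsHermitian) : (E A).IsHermitian := by
  rw [← cfc_id_h hA, sproj_sum, map_sum]
  refine sum_herm _ _ fun x => ?_
  rw [map_smul]
  exact smul_herm (hE.pos _ (proj_psd (sproj_herm A x) (sproj_idem A x))).1 x

theorem PosUnital.kadison {d : ℕ} {E : Matrix (Fin d) (Fin d) ℂ →ₗ[ℂ] Matrix (Fin d) (Fin d) ℂ} (hE : PosUnital E)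
    {A : Matrix (Fin d) (Fin d) ℂ} (hA : A.IsHermitian) : (E (A * A) - E A * E A).PosSemidef := by
  set S := A.finite_real_spectrum.toFinset with hS
  have e0 : ∑ x ∈ S, E (sproj A x) = 1 := by
    have := sproj_sum (A := A) (fun _ => 1)
    rw [cfc_one_h hA] at this
    rw [← map_sum, ← hE.unital, this]
    simp [hS]
  have e1 : ∑ x ∈ S, (x : ℂ) • E (sproj A x) = E A := by
    conv_rhs => rw [← cfc_id_h hA, sproj_sum, map_sum]
    simp [hS]
  have e2 : ∑ x ∈ S, ((x : ℂ) * x) • E (sproj A x) = E (A * A) := by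
    have : A * A = cfc (fun x : ℝ => x * x) A := by
      rw [cfc_mul _ _ A (contR _ _) (contR _ _), cfc_id_h hA]
    rw [this, sproj_sum, map_sum]
    simp [hS]
  have key : E (A * A) - E A * E A = ∑ x ∈ S, ((x : ℂ) • 1 - E A) * E (sproj A x) * ((x : ℂ) • 1 - E A)ᴴ := by
    have : ∀ x ∈ S, ((x : ℂ) • 1 - E A) * E (sproj A x) * ((x : ℂ) • 1 - E A)ᴴ
       = ((x : ℂ) * x) • E (sproj A x) - ((x : ℂ) • E (sproj A x)) * E A - E A * ((x : ℂ) • E (sproj A x)) + E A * E (sproj A x) * E A := by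
      intro x _
      rw [conjTranspose_sub, conjTranspose_smul, (hE.herm hA).eq, Complex.star_def, Complex.conj_ofReal,
        conjTranspose_one]
      generalize (x : ℂ) = c
      simp only [sub_mul, mul_sub, smul_smul, smul_mul_assoc, mul_smul_comm, one_mul, mul_one, smul_sub]
      abel
    rw [Finset.sum_congr rfl this, Finset.sum_add_distrib, Finset.sum_sub_distrib, Finset.sum_sub_distrib,
      ← Finset.sum_mul, ← Finset.sum_mul, ← Finset.mul_sum, ← Finset.mul_sum, e0, e1, e2]
    simp
  rw [key]
  exact posSemidef_sum _ fun x _ => (hE.pos _ (proj_psd (sproj_herm A x) (sproj_idem A x))).mul_mul_conjTranspose_same _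

/-- Cartesian decomposition. -/
theorem cartesian {d : ℕ} (z : Matrix (Fin d) (Fin d) ℂ) : ∃ h k : Matrix (Fin d) (Fin d) ℂ,
    h.IsHermitian ∧ k.IsHermitian ∧ z = h + Complex.I • k := by
  refine ⟨(realPart z : Matrix (Fin d) (Fin d) ℂ), (imaginaryPart z : Matrix (Fin d) (Fin d) ℂ), (realPart z).2, (imaginaryPart z).2, ?_⟩
  exact (realPart_add_I_smul_imaginaryPart z).symm

theorem PosUnital.map_star {d : ℕ} {E : Matrix (Fin d) (Fin d) ℂ →ₗ[ℂ] Matrix (Fin d) (Fin d) ℂ} (hE : PosUnital E)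
    (z : Matrix (Fin d) (Fin d) ℂ) : E zᴴ = (E z)ᴴ := by
  obtain ⟨h, k, hh, hk, rfl⟩ := cartesian z
  simp [conjTranspose_add, conjTranspose_smul, hh.eq, hk.eq, (hE.herm hh).eq, (hE.herm hk).eq]

theorem PosUnital.kadison2 {d : ℕ} {E : Matrix (Fin d) (Fin d) ℂ →ₗ[ℂ] Matrix (Fin d) (Fin d) ℂ} (hE : PosUnital E)
    (z : Matrix (Fin d) (Fin d) ℂ) :
    (E (zᴴ * z + z * zᴴ) - ((E z)ᴴ * E z + E z * (E z)ᴴ)).PosSemidef := by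
  obtain ⟨h, k, hh, hk, rfl⟩ := cartesian z
  have e : ∀ h k : Matrix (Fin d) (Fin d) ℂ, h.IsHermitian → k.IsHermitian →
     (h + Complex.I • k)ᴴ * (h + Complex.I • k) + (h + Complex.I • k) * (h + Complex.I • k)ᴴ
      = (2 : ℂ) • (h * h) + (2 : ℂ) • (k * k) := by
    intro h k hh hk
    simp only [conjTranspose_add, conjTranspose_smul, hh.eq, hk.eq]
    simp [add_mul, mul_add, smul_smul, two_smul]
    abel
  rw [map_add E h, map_smul, e h k hh hk, e _ _ (hE.herm hh) (hE.herm hk), map_add, map_smul, map_smul]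
  have := ((hE.kadison hh).add (hE.kadison hk)).smul (show (0 : ℂ) ≤ 2 by norm_num)
  convert this using 1
  simp only [smul_add, smul_sub]
  abel

theorem PosUnital.jordan {d : ℕ} {E : Matrix (Fin d) (Fin d) ℂ →ₗ[ℂ] Matrix (Fin d) (Fin d) ℂ} (hE : PosUnital E)
    {y : Matrix (Fin d) (Fin d) ℂ} (hy : y.IsHermitian) (h1 : E y = y) (h2 : E (y * y) = y * y)
    (x : Matrix (Fin d) (Fin d) ℂ) : E (x * y + y * x) = E x * y + y * E x := by
  have key : ∀ x : Matrix (Fin d) (Fin d) ℂ, x.IsHermitian → E (x * y + y * x) = E x * y + y * E x := by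
    intro x hx
    rw [← sub_eq_zero]
    apply psd_lin_s14 (C := E (x * x) - E x * E x)
    intro t
    have := hE.kadison (hx.add (smul_herm hy t))
    convert this using 1
    simp only [add_mul, mul_add, map_add, smul_mul_assoc, mul_smul_comm, map_smul, h1, h2, smul_add, smul_sub]
    abel
  obtain ⟨h, k, hh, hk, rfl⟩ := cartesian x
  have a := key h hh
  have b := key k hk
  have : (h + Complex.I • k) * y + y * (h + Complex.I • k) = (h * y + y * h) + Complex.I • (k * y + y * k) := by
    simp only [add_mul, mul_add, smul_mul_assoc, mul_smul_comm, smul_add]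
    abel
  rw [this, map_add, map_smul, a, b, map_add, map_smul]
  simp only [add_mul, mul_add, smul_mul_assoc, mul_smul_comm, smul_add]
  abel


structure CondExp {d : ℕ} (M : StarSubalgebra ℂ (Matrix (Fin d) (Fin d) ℂ))
    (E : Matrix (Fin d) (Fin d) ℂ →ₗ[ℂ] Matrix (Fin d) (Fin d) ℂ) : Prop extends PosUnital E where
  range : ∀ X, E X ∈ M
  id_on : ∀ X ∈ M, E X = X

theorem CondExp.offdiag {d : ℕ} {M : StarSubalgebra ℂ (Matrix (Fin d) (Fin d) ℂ)}
    {E : Matrix (Fin d) (Fin d) ℂ →ₗ[ℂ] Matrix (Fin d) (Fin d) ℂ} (hE : CondExp M E)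
    {p q : Matrix (Fin d) (Fin d) ℂ} (hp : p ∈ M) (hq : q ∈ M) (ph : p.IsHermitian) (qh : q.IsHermitian)
    (pp : p * p = p) (qq : q * q = q) (pq : p * q = 0) (qp : q * p = 0) (hpq : p + q = 1)
    (x : Matrix (Fin d) (Fin d) ℂ) : q * E (p * x * q) = 0 := by
  obtain ⟨s, hs⟩ : ∃ s, s = p * x * q := ⟨_, rfl⟩
  obtain ⟨w, hw⟩ : ∃ w, w = E s := ⟨_, rfl⟩
  rw [← hs, ← hw]
  have wM : w ∈ M := hw ▸ hE.range _
  have J : w = w * p + p * w := by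
    have := hE.jordan ph (hE.id_on p hp) (hE.id_on _ (mul_mem hp hp)) s
    have e : s * p + p * s = s := by
      rw [hs, Matrix.mul_assoc _ q p, qp, ← Matrix.mul_assoc, ← Matrix.mul_assoc, pp]; simp
    rwa [e, ← hw] at this
  have qwp : q * w = q * w * p := by
    conv_lhs => rw [J]
    rw [mul_add, ← Matrix.mul_assoc q p, qp, ← Matrix.mul_assoc]; simp
  obtain ⟨u, hu⟩ : ∃ u, u = q * w * p := ⟨_, rfl⟩
  obtain ⟨v, hv⟩ : ∃ v, v = p * w * q := ⟨_, rfl⟩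
  have uM : u ∈ M := hu ▸ mul_mem (mul_mem hq wM) hp
  have usM : uᴴ ∈ M := star_mem uM
  have huv : w = v + u := by
    have : w = (p + q) * w := by rw [hpq, one_mul]
    have pwq : p * w = p * w * q := by
      have h1 : p * w = p * w * p + p * w * q := by rw [← mul_add, hpq, mul_one]
      have h2 : p * w * p = 0 := by
        have h3 : p * w * p = p * w * p + p * w * p := by
          conv_lhs => rw [J]
          simp only [mul_add, add_mul]
          rw [Matrix.mul_assoc p (w * p) p, Matrix.mul_assoc w p p, pp, ← Matrix.mul_assoc p p w, pp,
            Matrix.mul_assoc]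
        simpa using h3
      rw [h2, zero_add] at h1
      exact h1
    rw [this, add_mul, hu, hv, ← qwp, ← pwq]
  have cross : ∀ a b : Matrix (Fin d) (Fin d) ℂ, (p * a * q)ᴴ * (q * b * p) = 0 ∧ (q * b * p)ᴴ * (p * a * q) = 0 ∧
      (p * a * q) * (q * b * p)ᴴ = 0 ∧ (q * b * p) * (p * a * q)ᴴ = 0 := by
    intro a b
    simp only [conjTranspose_mul, ph.eq, qh.eq]
    refine ⟨?_, ?_, ?_, ?_⟩
    · rw [show q * (aᴴ * p) * (q * b * p) = q * aᴴ * (p * q) * b * p by simp only [Matrix.mul_assoc], pq]; simp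
    · rw [show p * (bᴴ * q) * (p * a * q) = p * bᴴ * (q * p) * a * q by simp only [Matrix.mul_assoc], qp]; simp
    · rw [show p * a * q * (p * (bᴴ * q)) = p * a * (q * p) * bᴴ * q by simp only [Matrix.mul_assoc], qp]; simp
    · rw [show q * b * p * (q * (aᴴ * p)) = q * b * (p * q) * aᴴ * p by simp only [Matrix.mul_assoc], pq]; simp
  obtain ⟨c1, c2, c3, c4⟩ := cross x w
  obtain ⟨c5, c6, c7, c8⟩ := cross w w
  rw [← hs, ← hu] at c1 c2 c3 c4
  rw [← hv, ← hu] at c5 c6 c7 c8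
  have W0 : (-2 : ℂ) • (uᴴ * u + u * uᴴ) = 0 := by
    apply psd_lin_s14 (C := E (sᴴ * s + s * sᴴ) - (vᴴ * v + v * vᴴ) - (uᴴ * u + u * uᴴ))
    intro t
    have K := hE.kadison2 (s + (t : ℂ) • u)
    have st : star (t : ℂ) = t := by simp
    have f1 : (s + (t : ℂ) • u)ᴴ * (s + (t : ℂ) • u) + (s + (t : ℂ) • u) * (s + (t : ℂ) • u)ᴴ
        = (sᴴ * s + s * sᴴ) + ((t : ℂ) * t) • (uᴴ * u + u * uᴴ) := by
      simp only [conjTranspose_add, conjTranspose_smul, st, add_mul, mul_add, smul_mul_assoc, mul_smul_comm,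
        c1, c2, c3, c4, smul_smul, smul_zero, smul_add]
      abel
    have f2 : E (s + (t : ℂ) • u) = v + (1 + t : ℂ) • u := by
      rw [map_add, map_smul, hE.id_on u uM, ← hw, huv, add_smul, one_smul]; abel
    have st' : star (1 + t : ℂ) = 1 + t := by simp
    have f3 : (v + (1 + t : ℂ) • u)ᴴ * (v + (1 + t : ℂ) • u) + (v + (1 + t : ℂ) • u) * (v + (1 + t : ℂ) • u)ᴴ
        = (vᴴ * v + v * vᴴ) + ((1 + t : ℂ) * (1 + t)) • (uᴴ * u + u * uᴴ) := by
      rw [conjTranspose_add, conjTranspose_smul, st']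
      simp only [add_mul v, add_mul vᴴ, mul_add v, mul_add vᴴ, mul_add (_ • _), add_mul, mul_add, smul_mul_assoc, mul_smul_comm,
        c5, c6, c7, c8, smul_smul, smul_zero, smul_add]
      module
    rw [f1, f2, f3, map_add E (sᴴ * s + s * sᴴ), map_smul, hE.id_on _ (add_mem (mul_mem usM uM) (mul_mem uM usM))] at K
    convert K using 1
    module
  have W1 : uᴴ * u + u * uᴴ = 0 := by
    exact (smul_eq_zero.mp W0).resolve_left (by norm_num)
  have u0 : u = 0 := by
    have h1 := (posSemidef_conjTranspose_mul_self u).trace_nonneg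
    have h2 := congrArg Matrix.trace W1
    rw [trace_add, trace_mul_comm u, trace_zero] at h2
    rw [← trace_conjTranspose_mul_self_eq_zero_iff]
    have : (2 : ℂ) * (uᴴ * u).trace = 0 := by rw [two_mul]; exact h2
    simpa using this
  rw [qwp, ← hu, u0]

theorem CondExp.halfzero {d : ℕ} {M : StarSubalgebra ℂ (Matrix (Fin d) (Fin d) ℂ)}
    {E : Matrix (Fin d) (Fin d) ℂ →ₗ[ℂ] Matrix (Fin d) (Fin d) ℂ} (hE : CondExp M E)
    {p q : Matrix (Fin d) (Fin d) ℂ} (hp : p ∈ M) (hq : q ∈ M) (ph : p.IsHermitian) (qh : q.IsHermitian)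
    (pp : p * p = p) (qq : q * q = q) (pq : p * q = 0) (qp : q * p = 0) (hpq : p + q = 1)
    (x : Matrix (Fin d) (Fin d) ℂ) : q * E (p * x) = 0 := by
  have e : p * x = p * x * p + p * x * q := by rw [← mul_add, hpq, mul_one]
  rw [e, map_add, mul_add, hE.offdiag hp hq ph qh pp qq pq qp hpq x, add_zero]
  have J := hE.jordan ph (hE.id_on p hp) (hE.id_on _ (mul_mem hp hp)) (p * x * p)
  have e2 : p * x * p * p + p * (p * x * p) = (2 : ℂ) • (p * x * p) := by
    rw [Matrix.mul_assoc _ p p, pp, ← Matrix.mul_assoc p, ← Matrix.mul_assoc p, pp, two_smul]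
  rw [e2, map_smul] at J
  set w := E (p * x * p)
  have h1 : (2 : ℂ) • (q * w) = q * w * p := by
    rw [← mul_smul_comm, J, mul_add, ← Matrix.mul_assoc q p, qp]; simp [Matrix.mul_assoc]
  have h2 : (2 : ℂ) • (q * w * p) = q * w * p := by
    rw [← smul_mul_assoc, h1, Matrix.mul_assoc _ p p, pp]
  have h3 : q * w * p = 0 := by
    rw [two_smul] at h2; simpa using h2
  rw [h3] at h1
  simpa using h1

theorem CondExp.bimod_proj {d : ℕ} {M : StarSubalgebra ℂ (Matrix (Fin d) (Fin d) ℂ)}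
    {E : Matrix (Fin d) (Fin d) ℂ →ₗ[ℂ] Matrix (Fin d) (Fin d) ℂ} (hE : CondExp M E)
    {p : Matrix (Fin d) (Fin d) ℂ} (hp : p ∈ M) (ph : p.IsHermitian)
    (pp : p * p = p) (x : Matrix (Fin d) (Fin d) ℂ) : E (p * x) = p * E x := by
  obtain ⟨q, hq⟩ : ∃ q, q = 1 - p := ⟨_, rfl⟩
  have qM : q ∈ M := hq ▸ sub_mem (one_mem M) hp
  have qh : q.IsHermitian := hq ▸ isHermitian_one.sub ph
  have hpq : p + q = 1 := by rw [hq]; abel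
  have pq : p * q = 0 := by rw [hq, mul_sub, pp, mul_one, sub_self]
  have qp : q * p = 0 := by rw [hq, sub_mul, pp, one_mul, sub_self]
  have qq : q * q = q := by
    have : (p + q) * q = q := by rw [hpq, one_mul]
    rwa [add_mul, pq, zero_add] at this
  have h1 := hE.halfzero hp qM ph qh pp qq pq qp hpq x
  have h2 := hE.halfzero qM hp qh ph qq pp qp pq (by rw [add_comm]; exact hpq) x
  have h3 : E x = E (p * x) + E (q * x) := by rw [← map_add, ← add_mul, hpq, one_mul]
  rw [h3, mul_add, h2, add_zero]
  have : E (p * x) = (p + q) * E (p * x) := by rw [hpq, one_mul]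
  rw [add_mul, h1, add_zero] at this
  exact this

theorem cartesian_mem {d : ℕ} {M : StarSubalgebra ℂ (Matrix (Fin d) (Fin d) ℂ)} {z : Matrix (Fin d) (Fin d) ℂ} (hz : z ∈ M) :
    ∃ h ∈ M, ∃ k ∈ M, h.IsHermitian ∧ k.IsHermitian ∧ z = h + Complex.I • k := by
  have zs : star z ∈ M := star_mem hz
  refine ⟨(realPart z : Matrix (Fin d) (Fin d) ℂ), ?_, (imaginaryPart z : Matrix (Fin d) (Fin d) ℂ), ?_, (realPart z).2, (imaginaryPart z).2, ?_⟩
  · rw [realPart_apply_coe, show (2⁻¹ : ℝ) • (z + star z) = (2⁻¹ : ℂ) • (z + star z) by ext; simp [mul_add]]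
    exact M.smul_mem (add_mem hz zs) _
  · rw [imaginaryPart_apply_coe, show (2⁻¹ : ℝ) • (z - star z) = (2⁻¹ : ℂ) • (z - star z) by ext; simp [mul_sub]]
    exact M.smul_mem (M.smul_mem (sub_mem hz zs) _) _
  · exact (realPart_add_I_smul_imaginaryPart z).symm

theorem CondExp.bimod {d : ℕ} {M : StarSubalgebra ℂ (Matrix (Fin d) (Fin d) ℂ)}
    {E : Matrix (Fin d) (Fin d) ℂ →ₗ[ℂ] Matrix (Fin d) (Fin d) ℂ} (hE : CondExp M E)
    {y : Matrix (Fin d) (Fin d) ℂ} (hy : y ∈ M) (x : Matrix (Fin d) (Fin d) ℂ) : E (y * x) = y * E x := by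
  have key : ∀ h ∈ M, h.IsHermitian → E (h * x) = h * E x := by
    intro h hM hh
    have e : h = ∑ t ∈ h.finite_real_spectrum.toFinset, ((t : ℝ) : ℂ) • sproj h t := by
      have := sproj_sum (A := h) (fun x => x)
      rwa [cfc_id_h hh] at this
    have : ∀ t, E (sproj h t * x) = sproj h t * E x := fun t =>
      hE.bimod_proj (mcfc_mem hh hM _) (sproj_herm _ _) (sproj_idem _ _) x
    conv_lhs => rw [e]
    conv_rhs => rw [e]
    simp only [Finset.sum_mul, smul_mul_assoc, map_sum, map_smul, this]
  obtain ⟨h, hM, k, kM, hh, hk, rfl⟩ := cartesian_mem hy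
  rw [add_mul, smul_mul_assoc, map_add, map_smul, key h hM hh, key k kM hk, add_mul, smul_mul_assoc]

theorem trace_nondeg {d : ℕ} {A : Matrix (Fin d) (Fin d) ℂ} (h : ∀ Y : Matrix (Fin d) (Fin d) ℂ, (A * Y).trace = 0) : A = 0 := by
  rw [← trace_mul_conjTranspose_self_eq_zero_iff]
  exact h _

theorem sqrt_mul_sqrt {d : ℕ} {σ : Matrix (Fin d) (Fin d) ℂ} (hσ : σ.PosSemidef) :
    cfc Real.sqrt σ * cfc Real.sqrt σ = σ := by
  rw [← cfc_mul _ _ σ (contR _ _) (contR _ _)]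
  conv_rhs => rw [← cfc_id_h hσ.1]
  refine cfc_congr fun x hx => ?_
  exact Real.mul_self_sqrt (spec_nonneg hσ hx)

theorem sqrt_mul_inv {d : ℕ} {σ : Matrix (Fin d) (Fin d) ℂ} (hσ : σ.PosDef) :
    cfc Real.sqrt σ * cfc (fun x : ℝ => (Real.sqrt x)⁻¹) σ = 1 := by
  rw [← cfc_mul _ _ σ (contR _ _) (contR _ _)]
  rw [← cfc_one_h hσ.1]
  refine cfc_congr fun x hx => ?_
  exact mul_inv_cancel₀ (Real.sqrt_pos.mpr (spec_pos hσ hx)).ne'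

theorem inv_mul_sqrt {d : ℕ} {σ : Matrix (Fin d) (Fin d) ℂ} (hσ : σ.PosDef) :
    cfc (fun x : ℝ => (Real.sqrt x)⁻¹) σ * cfc Real.sqrt σ = 1 :=
  mul_eq_one_comm.mp (sqrt_mul_inv hσ)

theorem cancel_lr {d : ℕ} {s r X : Matrix (Fin d) (Fin d) ℂ} (sr : s * r = 1) (h : s * X * s = 0) : X = 0 := by
  have rs : r * s = 1 := mul_eq_one_comm.mp sr
  have : r * (s * X * s) * r = X := by
    rw [show r * (s * X * s) * r = (r * s) * X * (s * r) by simp only [Matrix.mul_assoc], sr, rs]; simp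
  rw [← this, h]; simp

theorem CondExp.modular {d : ℕ} {M : StarSubalgebra ℂ (Matrix (Fin d) (Fin d) ℂ)}
    {E : Matrix (Fin d) (Fin d) ℂ →ₗ[ℂ] Matrix (Fin d) (Fin d) ℂ} (hE : CondExp M E)
    {σ s r : Matrix (Fin d) (Fin d) ℂ} (ss : s * s = σ) (sr : s * r = 1)
    (hk : ∀ X Y, ((s * X * s) * E Y).trace = ((s * E X * s) * Y).trace)
    (hσ : ∀ X, (σ * E X).trace = (σ * X).trace)
    {y : Matrix (Fin d) (Fin d) ℂ} (hy : y ∈ M) : s * y * r ∈ M := by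
  have rs : r * s = 1 := mul_eq_one_comm.mp sr
  have e : s * (s * y * r) * s = σ * y := by
    rw [show s * (s * y * r) * s = (s * s) * y * (r * s) by simp only [Matrix.mul_assoc], ss, rs, mul_one]
  have h : E (s * y * r) - s * y * r = 0 := by
    apply cancel_lr sr
    apply trace_nondeg
    intro Y
    rw [mul_sub, sub_mul, sub_mul, trace_sub, ← hk, e, Matrix.mul_assoc, ← hE.bimod hy, hσ, Matrix.mul_assoc, sub_self]
  rw [sub_eq_zero] at h
  rw [← h]
  exact hE.range _

theorem exists_density {d : ℕ} (M : StarSubalgebra ℂ (Matrix (Fin d) (Fin d) ℂ)) (σ : Matrix (Fin d) (Fin d) ℂ) :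
    ∃ a ∈ M, ∀ y ∈ M, (a * y).trace = (σ * y).trace := by
  let L : M →ₗ[ℂ] Module.Dual ℂ M :=
    LinearMap.mk₂ ℂ (fun a y : M => ((a : Matrix (Fin d) (Fin d) ℂ) * y).trace)
      (by intros; simp [add_mul]) (by intros; simp) (by intros; simp [mul_add]) (by intros; simp)
  have inj : Function.Injective L := by
    rw [injective_iff_map_eq_zero]
    intro a ha
    have := LinearMap.congr_fun ha (star a)
    have h2 : ((a : Matrix (Fin d) (Fin d) ℂ) * (a : Matrix (Fin d) (Fin d) ℂ)ᴴ).trace = 0 := this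
    rw [trace_mul_conjTranspose_self_eq_zero_iff] at h2
    exact Subtype.ext h2
  have : FiniteDimensional ℂ M := FiniteDimensional.finiteDimensional_submodule M.toSubalgebra.toSubmodule
  have surj : Function.Surjective L :=
    (LinearMap.injective_iff_surjective_of_finrank_eq_finrank (Subspace.dual_finrank_eq).symm).mp inj
  let φ : Module.Dual ℂ M :=
    { toFun := fun y => (σ * (y : Matrix (Fin d) (Fin d) ℂ)).trace
      map_add' := by intros; simp [mul_add]
      map_smul' := by intros; simp }
  obtain ⟨a, ha⟩ := surj φ
  exact ⟨a, a.2, fun y hy => LinearMap.congr_fun ha ⟨y, hy⟩⟩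

theorem mem_nondeg {d : ℕ} {M : StarSubalgebra ℂ (Matrix (Fin d) (Fin d) ℂ)} {A : Matrix (Fin d) (Fin d) ℂ} (hA : A ∈ M)
    (h : ∀ Y ∈ M, (A * Y).trace = 0) : A = 0 := by
  rw [← trace_mul_conjTranspose_self_eq_zero_iff]
  exact h _ (star_mem hA)

theorem posDef_conj {d : ℕ} {A s r : Matrix (Fin d) (Fin d) ℂ} (hA : A.PosDef) (hs : s.IsHermitian) (sr : s * r = 1) :
    (s * A * s).PosDef := by
  have := hA.mul_mul_conjTranspose_same (B := s) ?_
  · rwa [hs.eq] at this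
  · intro x y hxy
    have := congrArg (fun v => v ᵥ* r) hxy
    simpa [vecMul_vecMul, sr] using this

theorem trace_pos_proj {d : ℕ} {σ p : Matrix (Fin d) (Fin d) ℂ} (hσ : σ.PosDef) (hp : p.IsHermitian) (pp : p * p = p)
    (h : (σ * p).trace.re ≤ 0) : p = 0 := by
  have e : (σ * p).trace = (p * σ * pᴴ).trace := by
    rw [hp.eq, trace_mul_comm (p * σ) p, ← Matrix.mul_assoc, pp, trace_mul_comm]
  have hpsd := hσ.posSemidef.mul_mul_conjTranspose_same p
  have h0 := hpsd.trace_nonneg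
  rw [← e] at h0
  have h1 : (σ * p).trace = 0 := by
    obtain ⟨hr, hi⟩ := Complex.le_def.mp h0
    exact Complex.ext (le_antisymm h hr) hi.symm
  rw [e, hpsd.trace_eq_zero_iff] at h1
  obtain ⟨s, r, ss, sr, hs⟩ : ∃ s r : Matrix (Fin d) (Fin d) ℂ, s * s = σ ∧ s * r = 1 ∧ s.IsHermitian :=
    ⟨_, _, sqrt_mul_sqrt hσ.posSemidef, sqrt_mul_inv hσ, cfc_herm _ _⟩
  have h2 : (p * s) * (p * s)ᴴ = 0 := by
    rw [conjTranspose_mul, hs.eq, ← h1, ← ss]; simp only [Matrix.mul_assoc]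
  have h3 : p * s = 0 := self_mul_conjTranspose_eq_zero.mp h2
  have : p * s * r = p := by rw [Matrix.mul_assoc, sr, mul_one]
  rw [← this, h3, zero_mul]

theorem density_posDef {d : ℕ} {M : StarSubalgebra ℂ (Matrix (Fin d) (Fin d) ℂ)} {σ a : Matrix (Fin d) (Fin d) ℂ}
    (hσ : σ.PosDef) (aM : a ∈ M) (ha : ∀ y ∈ M, (a * y).trace = (σ * y).trace) : a.PosDef := by
  have ah : a.IsHermitian := by
    have asM : aᴴ ∈ M := star_mem aM
    have : aᴴ - a = 0 := by
      apply mem_nondeg (sub_mem asM aM)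
      intro Y hY
      have h1 : (a * Yᴴ).trace = (σ * Yᴴ).trace := ha _ (star_mem hY)
      have h2 := congrArg star h1
      rw [← trace_conjTranspose, ← trace_conjTranspose, conjTranspose_mul, conjTranspose_mul, hσ.1.eq, conjTranspose_conjTranspose,
        trace_mul_comm, trace_mul_comm Y] at h2
      rw [sub_mul, trace_sub, h2, ha Y hY, sub_self]
    exact sub_eq_zero.mp this
  refine ah.posDef_iff_eigenvalues_pos.mpr fun i => ?_
  by_contra hneg
  push Not at hneg
  set t := ah.eigenvalues i
  have p0 : sproj a t = 0 := by
    apply trace_pos_proj hσ (sproj_herm _ _) (sproj_idem _ _)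
    rw [← ha (sproj a t) (mcfc_mem ah aM _)]
    have : a * sproj a t = (t : ℂ) • sproj a t := by
      have e : cfc (fun y : ℝ => y * (if y = t then 1 else 0)) a = cfc (fun y : ℝ => t * (if y = t then 1 else 0)) a := by
        refine cfc_congr fun y _ => ?_
        by_cases h : y = t <;> simp [h]
      rw [cfc_mul _ _ a (contR _ _) (contR _ _), cfc_id_h ah, cfc_const_mul _ _ a (contR _ _)] at e
      simpa [sproj] using e
    rw [this, trace_smul, smul_eq_mul, Complex.re_ofReal_mul]
    exact mul_nonpos_of_nonpos_of_nonneg hneg (Complex.le_def.mp (proj_psd (sproj_herm a t) (sproj_idem a t)).trace_nonneg).1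
  have hmem : t ∈ spectrum ℝ a := ah.eigenvalues_mem_spectrum_real i
  have : (1 : ℝ) ∈ spectrum ℝ (sproj a t) := by
    unfold sproj
    rw [cfc_map_spectrum _ a ah.isSelfAdjoint (contR _ _)]
    exact ⟨t, hmem, by simp⟩
  rw [p0] at this
  rw [spectrum.mem_iff] at this
  simp at this

theorem CondExp.factor {d : ℕ} {M : StarSubalgebra ℂ (Matrix (Fin d) (Fin d) ℂ)}
    {E : Matrix (Fin d) (Fin d) ℂ →ₗ[ℂ] Matrix (Fin d) (Fin d) ℂ} (hE : CondExp M E)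
    {σ s r : Matrix (Fin d) (Fin d) ℂ} (hσp : σ.PosDef) (ss : s * s = σ) (sr : s * r = 1)
    (hk : ∀ X Y, ((s * X * s) * E Y).trace = ((s * E X * s) * Y).trace)
    (hσ : ∀ X, (σ * E X).trace = (σ * X).trace) :
    ∃ a ∈ M, ∃ b, a.PosDef ∧ b.PosDef ∧ (∀ x ∈ M, b * x = x * b) ∧ σ = a * b := by
  obtain ⟨a, aM, ha⟩ := exists_density M σ
  have apd := density_posDef hσp aM ha
  obtain ⟨u, v, uM, vM, uu, uv, uh, vh⟩ : ∃ u v : Matrix (Fin d) (Fin d) ℂ, u ∈ M ∧ v ∈ M ∧ u * u = a ∧ u * v = 1 ∧ u.IsHermitian ∧ v.IsHermitian :=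
    ⟨_, _, mcfc_mem apd.1 aM _, mcfc_mem apd.1 aM _, sqrt_mul_sqrt apd.posSemidef, sqrt_mul_inv apd, cfc_herm _ _, cfc_herm _ _⟩
  have vu : v * u = 1 := mul_eq_one_comm.mp uv
  have rs : r * s = 1 := mul_eq_one_comm.mp sr
  have av : a * (v * v) = 1 := by
    rw [← uu, show u * u * (v * v) = u * (u * v) * v by simp only [Matrix.mul_assoc], uv, mul_one, uv]
  have va : (v * v) * a = 1 := mul_eq_one_comm.mp av
  have hmod : ∀ x ∈ M, a * x = s * (s * x * r) * r * a := by
    intro x hx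
    have m2 : s * (s * x * r) * r ∈ M := hE.modular ss sr hk hσ (hE.modular ss sr hk hσ hx)
    have : a * x - s * (s * x * r) * r * a = 0 := by
      apply mem_nondeg (sub_mem (mul_mem aM hx) (mul_mem m2 aM))
      intro y hy
      rw [sub_mul, trace_sub, Matrix.mul_assoc a, ha _ (mul_mem hx hy), Matrix.mul_assoc _ a y, trace_mul_comm _ (a * y),
        Matrix.mul_assoc a y, ha _ (mul_mem hy m2)]
      have e : (σ * (y * (s * (s * x * r) * r))).trace = (σ * (x * y)).trace := by
        rw [← ss, trace_mul_comm]
        rw [show y * (s * (s * x * r) * r) * (s * s) = y * (s * s * x * (r * (r * s) * s)) by simp only [Matrix.mul_assoc], rs, mul_one, rs,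
          mul_one, trace_mul_comm]
        simp only [Matrix.mul_assoc]
      rw [e, sub_self]
    exact sub_eq_zero.mp this
  have hmod' : ∀ x ∈ M, a * x * (v * v) * σ = σ * x := by
    intro x hx
    rw [hmod x hx, ← ss]
    rw [show s * (s * x * r) * r * a * (v * v) * (s * s) = s * s * x * (r * (r * (a * (v * v)) * s) * s) by simp only [Matrix.mul_assoc], av,
      mul_one, rs, mul_one, rs, mul_one]
  have bcomm : ∀ x ∈ M, (v * v * σ) * x = x * (v * v * σ) := by
    intro x hx
    rw [Matrix.mul_assoc, ← hmod' x hx, show v * v * (a * x * (v * v) * σ) = (v * v * a) * (x * (v * v * σ)) by simp only [Matrix.mul_assoc], va, one_mul]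
  refine ⟨a, aM, v * v * σ, apd, ?_, bcomm, ?_⟩
  · have : v * v * σ = v * σ * v := by
      have h := bcomm u uM
      have h2 := congrArg (fun z => z * v) h
      simp only [Matrix.mul_assoc, uv, mul_one] at h2
      rw [Matrix.mul_assoc, h2, show u * (v * (v * (σ * v))) = (u * v) * (v * σ * v) by simp only [Matrix.mul_assoc], uv, one_mul]
    rw [this]
    exact posDef_conj hσp vh vu
  · rw [← Matrix.mul_assoc, av, one_mul]

theorem cfc_add_const_h {d : ℕ} {A : Matrix (Fin d) (Fin d) ℂ} (hA : A.IsHermitian) (ε : ℝ) :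
    cfc (fun x : ℝ => x + ε) A = A + (ε : ℂ) • 1 := by
  rw [cfc_add A _ _ (contR _ _) (contR _ _), cfc_id_h hA]
  have := cfc_const_mul ε (fun _ : ℝ => (1 : ℝ)) A (contR _ _)
  rw [cfc_one_h hA] at this
  simp only [mul_one] at this
  rw [this]
  congr 1

theorem cfc_log_add {d : ℕ} {A : Matrix (Fin d) (Fin d) ℂ} (hA : A.IsHermitian) (ε : ℝ) :
    cfc Real.log (A + (ε : ℂ) • 1) = cfc (fun x : ℝ => Real.log (x + ε)) A := by
  rw [← cfc_add_const_h hA]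
  exact (cfc_comp' Real.log (fun x : ℝ => x + ε) A ((A.finite_real_spectrum.image _).continuousOn _) (contR _ _) hA.isSelfAdjoint).symm

theorem support_absorb {d : ℕ} {ρ e : Matrix (Fin d) (Fin d) ℂ} (hρ : ρ.PosSemidef) (he : e.IsHermitian) (ee : e * e = e)
    (h : (ρ * e).trace = 0) : ρ * e = 0 := by
  have h1 : (ρ * e).trace = (e * ρ * eᴴ).trace := by
    rw [he.eq, trace_mul_comm (e * ρ) e, ← Matrix.mul_assoc, ee, trace_mul_comm]
  rw [h1, (hρ.mul_mul_conjTranspose_same e).trace_eq_zero_iff, ← sqrt_mul_sqrt hρ] at h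
  have qh : (cfc Real.sqrt ρ).IsHermitian := cfc_herm _ _
  have h2 : (e * cfc Real.sqrt ρ) * (e * cfc Real.sqrt ρ)ᴴ = 0 := by
    rw [conjTranspose_mul, qh.eq, ← h]; simp only [Matrix.mul_assoc]
  have h3 := self_mul_conjTranspose_eq_zero.mp h2
  have h4 := congrArg conjTranspose h3
  rw [conjTranspose_mul, qh.eq, he.eq, conjTranspose_zero] at h4
  rw [← sqrt_mul_sqrt hρ, Matrix.mul_assoc, h4, mul_zero]

/-- For a conditional expectation `E` onto `M` compatible with a
full-rank state `σ`, and a state `ρ` with `X := Γ_σ^{-1}(ρ)`, the generalized entropy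
`Ent_{1,M}(X) = D(ρ‖E_*(ρ)) = D_Lin(ρ‖Γ_σ(E(X)))` is the infimum over full-rank positive
`Y ∈ M` of `D_Lin(ρ‖Γ_σ(Y))` (and the infimum is attained at `Y = E(X)`). -/
theorem ent_variational_formula
    {d : ℕ} (Malg : StarSubalgebra ℂ (Matrix (Fin d) (Fin d) ℂ))
    (σ : Matrix (Fin d) (Fin d) ℂ) (hσ : σ.PosDef) (hσtr : σ.trace = 1)
    (E : Matrix (Fin d) (Fin d) ℂ →ₗ[ℂ] Matrix (Fin d) (Fin d) ℂ)
    (hrange : ∀ X, E X ∈ Malg) (hid : ∀ X ∈ Malg, E X = X)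
    (hunital : E 1 = 1)
    (hpos : ∀ X : Matrix (Fin d) (Fin d) ℂ, X.PosSemidef → (E X).PosSemidef)
    (hkms : ∀ X Y, ((matSqrt σ * Xᴴ * matSqrt σ) * E Y).trace
      = ((matSqrt σ * (E X)ᴴ * matSqrt σ) * Y).trace)
    (hσinv : ∀ X, (σ * E X).trace = (σ * X).trace)
    (ρ : Matrix (Fin d) (Fin d) ℂ) (hρ : ρ.PosSemidef) (hρtr : ρ.trace = 1) :
    IsGLB {x : ℝ | ∃ Y ∈ Malg, Y.PosDef ∧ x = DLin ρ (Gam σ Y)}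
      (DLin ρ (Gam σ (E (GamInv σ ρ)))) := by
  have hE : CondExp Malg E := ⟨⟨hunital, hpos⟩, hrange, hid⟩
  obtain ⟨s, hs⟩ : ∃ s, s = matSqrt σ := ⟨_, rfl⟩
  obtain ⟨r, hr⟩ : ∃ r, r = matInvSqrt σ := ⟨_, rfl⟩
  have ss : s * s = σ := hs ▸ sqrt_mul_sqrt hσ.posSemidef
  have sr : s * r = 1 := by rw [hs, hr]; exact sqrt_mul_inv hσ
  have rs : r * s = 1 := mul_eq_one_comm.mp sr
  have sh : s.IsHermitian := hs ▸ cfc_herm _ _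
  have rh : r.IsHermitian := hr ▸ cfc_herm _ _
  rw [← hs] at hkms
  have hk : ∀ X Y, ((s * X * s) * E Y).trace = ((s * E X * s) * Y).trace := by
    intro X Y
    have := hkms Xᴴ Y
    rwa [hE.map_star, conjTranspose_conjTranspose, conjTranspose_conjTranspose] at this
  obtain ⟨a, aM, b, apd, bpd, bcomm, hab⟩ := hE.factor hσ ss sr hk hσinv
  have abc : a * b = b * a := (bcomm a aM).symm
  obtain ⟨u, hu⟩ : ∃ u, u = cfc Real.sqrt a := ⟨_, rfl⟩
  obtain ⟨v, hv⟩ : ∃ v, v = cfc (fun x : ℝ => (Real.sqrt x)⁻¹) a := ⟨_, rfl⟩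
  obtain ⟨w, hw⟩ : ∃ w, w = cfc Real.sqrt b := ⟨_, rfl⟩
  have uM : u ∈ Malg := hu ▸ mcfc_mem apd.1 aM _
  have vM : v ∈ Malg := hv ▸ mcfc_mem apd.1 aM _
  have uh : u.IsHermitian := hu ▸ cfc_herm _ _
  have vh : v.IsHermitian := hv ▸ cfc_herm _ _
  have uv : u * v = 1 := by rw [hu, hv]; exact sqrt_mul_inv apd
  have vu : v * u = 1 := mul_eq_one_comm.mp uv
  have ww : w * w = b := hw ▸ sqrt_mul_sqrt bpd.posSemidef
  have wc : ∀ x ∈ Malg, w * x = x * w := fun x hx => hw ▸ cfc_comm_s14 (bcomm x hx) _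
  have suw : s = u * w := by
    rw [hs, hu, hw, matSqrt, hab, cfc_sqrt_mul apd.posSemidef bpd.posSemidef abc]
  have gam : ∀ Y ∈ Malg, s * Y * s = (u * Y * u) * b := by
    intro Y hY
    rw [suw, ← ww]
    calc u * w * Y * (u * w) = u * (w * (Y * u)) * w := by simp only [Matrix.mul_assoc]
      _ = u * Y * u * (w * w) := by rw [wc _ (mul_mem hY uM)]; simp only [Matrix.mul_assoc]
  obtain ⟨X, hX⟩ : ∃ X, X = r * ρ * r := ⟨_, rfl⟩
  have Xpsd : X.PosSemidef := by
    have := hρ.mul_mul_conjTranspose_same r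
    rwa [rh.eq, ← hX] at this
  have sXs : s * X * s = ρ := by
    rw [hX, show s * (r * ρ * r) * s = (s * r) * ρ * (r * s) by simp only [Matrix.mul_assoc], sr, rs]; simp
  obtain ⟨A', hA'⟩ : ∃ A', A' = u * E X * u := ⟨_, rfl⟩
  have A'M : A' ∈ Malg := hA' ▸ mul_mem (mul_mem uM (hrange X)) uM
  have A'psd : A'.PosSemidef := by
    have := (hpos X Xpsd).mul_mul_conjTranspose_same u
    rwa [uh.eq, ← hA'] at this
  obtain ⟨A, hA⟩ : ∃ A, A = s * E X * s := ⟨_, rfl⟩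
  have Apsd : A.PosSemidef := by
    have := (hpos X Xpsd).mul_mul_conjTranspose_same s
    rwa [sh.eq, ← hA] at this
  have AA' : A = A' * b := by rw [hA, hA', gam _ (hrange X)]
  have trA : ∀ z ∈ Malg, (ρ * z).trace = (A * z).trace := by
    intro z hz
    have := hk X z
    rwa [hid z hz, sXs, ← hA] at this
  obtain ⟨p, hp⟩ : ∃ p, p = cfc (fun x : ℝ => if x = 0 then (0 : ℝ) else 1) A' := ⟨_, rfl⟩
  have pM : p ∈ Malg := hp ▸ mcfc_mem A'psd.1 A'M _
  have ph : p.IsHermitian := hp ▸ cfc_herm _ _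
  have pp : p * p = p := by
    rw [hp, ← cfc_mul _ _ A' (contR _ _) (contR _ _)]
    refine cfc_congr fun y _ => ?_
    by_cases h : y = 0 <;> simp [h]
  have A'p : A' * p = A' := by
    have e : cfc (fun x : ℝ => x * (if x = 0 then (0 : ℝ) else 1)) A' = cfc (fun x : ℝ => x) A' := by
      refine cfc_congr fun y _ => ?_
      by_cases h : y = 0 <;> simp [h]
    rwa [cfc_mul _ _ A' (contR _ _) (contR _ _), cfc_id_h A'psd.1, ← hp] at e
  have Ap : A * p = A := by
    rw [AA', Matrix.mul_assoc, bcomm p pM, ← Matrix.mul_assoc, A'p]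
  have ρp : ρ * p = ρ := by
    have h1 : ρ * (1 - p) = 0 := by
      apply support_absorb hρ (isHermitian_one.sub ph)
      · simp [mul_sub, sub_mul, pp]
      · rw [trA _ (sub_mem (one_mem _) pM), mul_sub, Ap]; simp
    rw [mul_sub, mul_one, sub_eq_zero] at h1
    exact h1.symm
  have bA' : A' * b = b * A' := (bcomm A' A'M).symm
  have logA : cfc Real.log A = cfc Real.log A' + p * cfc Real.log b := by
    rw [AA', hp, cfc_log_mul A'psd bpd bA']
  have lA'M : cfc Real.log A' ∈ Malg := mcfc_mem A'psd.1 A'M _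
  have t1 : (ρ * cfc Real.log A).trace = (A * cfc Real.log A').trace + (ρ * cfc Real.log b).trace := by
    rw [logA, mul_add, trace_add, ← Matrix.mul_assoc, ρp, trA _ lA'M]
  have t2 : (A * cfc Real.log A).trace = (A * cfc Real.log A').trace + (A * cfc Real.log b).trace := by
    rw [logA, mul_add, trace_add, ← Matrix.mul_assoc, Ap]
  have lB : ∀ Y ∈ Malg, Y.PosDef → (s * Y * s).PosDef ∧ ∀ C : Matrix (Fin d) (Fin d) ℂ, (C * cfc Real.log (s * Y * s)).trace = (C * cfc Real.log (u * Y * u)).trace + (C * cfc Real.log b).trace := by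
    intro Y hY Yp
    have Y'M : u * Y * u ∈ Malg := mul_mem (mul_mem uM hY) uM
    refine ⟨posDef_conj Yp sh sr, fun C => ?_⟩
    rw [gam Y hY, cfc_log_mul' (posDef_conj Yp uh uv) bpd (bcomm _ Y'M).symm, mul_add, trace_add]
  have trAρ : ρ.trace = A.trace := by simpa using trA 1 (one_mem _)
  have goalA : Gam σ (E (GamInv σ ρ)) = A := by
    simp only [Gam, GamInv, ← hs, ← hr, ← hX, hA]
  rw [goalA]
  constructor
  · rintro _ ⟨Y, hY, Yp, rfl⟩
    obtain ⟨Bp, HB⟩ := lB Y hY Yp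
    have Y'p := posDef_conj Yp uh uv
    have Y'M : u * Y * u ∈ Malg := mul_mem (mul_mem uM hY) uM
    have K := klein Apsd Bp
    have t3 := HB ρ
    have t4 := HB A
    rw [trA _ (mcfc_mem Y'p.1 Y'M _)] at t3
    simp only [DLin, matLog, Gam, ← hs]
    rw [mul_sub, trace_sub, t2, t4] at K
    rw [mul_sub, mul_sub, trace_sub, trace_sub, t1, t3]
    simp only [Complex.sub_re, Complex.add_re] at K ⊢
    linarith
  · intro l hl
    have bt : 0 ≤ b.trace.re := (Complex.le_def.mp bpd.posSemidef.trace_nonneg).1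
    have main : ∀ ε : ℝ, 0 < ε → l ≤ DLin ρ A + ε * b.trace.re := by
      intro ε hε
      obtain ⟨Z, hZ⟩ : ∃ Z, Z = A' + (ε : ℂ) • (1 : Matrix (Fin d) (Fin d) ℂ) := ⟨_, rfl⟩
      have Zp : Z.PosDef := by
        rw [hZ]
        refine PosDef.posSemidef_add A'psd (PosDef.one.smul ?_)
        exact_mod_cast hε
      have ZM : Z ∈ Malg := hZ ▸ add_mem A'M (Malg.smul_mem (one_mem _) _)
      have YM : v * Z * v ∈ Malg := mul_mem (mul_mem vM ZM) vM
      have Yp : (v * Z * v).PosDef := posDef_conj Zp vh vu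
      have hZ' : u * (v * Z * v) * u = Z := by
        rw [show u * (v * Z * v) * u = (u * v) * Z * (v * u) by simp only [Matrix.mul_assoc], uv, vu]; simp
      obtain ⟨Bp, HB⟩ := lB _ YM Yp
      have t3 := HB ρ
      rw [hZ', trA _ (mcfc_mem Zp.1 ZM _)] at t3
      have h1 : l ≤ DLin ρ (Gam σ (v * Z * v)) := hl ⟨_, YM, Yp, rfl⟩
      refine h1.trans ?_
      have trB : (s * (v * Z * v) * s).trace = A.trace + (ε : ℂ) * b.trace := by
        rw [gam _ YM, hZ', hZ, add_mul, trace_add, ← AA', smul_mul_assoc, one_mul, trace_smul, smul_eq_mul]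
      have ineq : 0 ≤ (A * cfc Real.log Z).trace.re - (A * cfc Real.log A').trace.re := by
        have e : A * cfc Real.log Z - A * cfc Real.log A' = b * cfc (fun x : ℝ => x * (Real.log (x + ε) - Real.log x)) A' := by
          rw [cfc_mul _ _ A' (contR _ _) (contR _ _), cfc_sub _ _ A' (contR _ _) (contR _ _), cfc_id_h A'psd.1, hZ,
            cfc_log_add A'psd.1, AA', bA', ← mul_sub, Matrix.mul_assoc]
        rw [← Complex.sub_re, ← trace_sub, e, trace_mul_comm]
        apply trace_cfc_nonneg A'psd.1 bpd.posSemidef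
        intro x hx
        rcases (spec_nonneg A'psd hx).eq_or_lt with h | h
        · rw [← h]; simp
        · exact mul_nonneg h.le (sub_nonneg.mpr (Real.log_le_log h (by linarith)))
      simp only [DLin, matLog, Gam, ← hs]
      rw [mul_sub, mul_sub, trace_sub, trace_sub, t1, t3, trB]
      simp only [Complex.sub_re, Complex.add_re, Complex.re_ofReal_mul]
      linarith
    refine le_of_forall_pos_le_add fun δ hδ => ?_
    refine (main (δ / (b.trace.re + 1)) (by positivity)).trans ?_
    have : δ / (b.trace.re + 1) * b.trace.re ≤ δ := by
      rw [div_mul_eq_mul_div, div_le_iff₀ (by positivity)]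
      nlinarith
    linarith

end
end
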